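/- arXiv:1007.2248 — 5 statements merged into one kernel-verified Lean document; each statement's English description precedes it below -/
import Mathlib

section
/- Let H be a finite simple graph on vertex set {1,…,v} with e ≥ 1 edges, and let A_H be the associated 2e×v XOR game. Then the quantum bias satisfies ε_q(A_H) = 1/√2, the classical bias of A_H equals 1/2, and every marginal row bias of A_H equals 1/(2√2·e). -/
open scoped BigOperators RealInnerProductSpace
open Matrix Kronecker

noncomputable section

/-- An XOR game is given by a cost matrix whose absolute entries sum to 1. -/
def isXORGame {ι κ : Type*} [Fintype ι] [Fintype κ] (G : Matrix ι κ ℝ) : Prop :=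
  ∑ i, ∑ j, |G i j| = 1

/-- The bias of a vector strategy. -/
def stratBias {ι κ : Type*} [Fintype ι] [Fintype κ] (G : Matrix ι κ ℝ) {N : ℕ}
    (u : ι → EuclideanSpace ℝ (Fin N)) (v : κ → EuclideanSpace ℝ (Fin N)) : ℝ :=
  ∑ i, ∑ j, G i j * ⟪u i, v j⟫

/-- The quantum bias of an XOR game: supremum of biases of vector strategies. -/
def quantumBias {ι κ : Type*} [Fintype ι] [Fintype κ] (G : Matrix ι κ ℝ) : ℝ :=
  sSup {b : ℝ | ∃ (N : ℕ) (u : ι → EuclideanSpace ℝ (Fin N))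
      (v : κ → EuclideanSpace ℝ (Fin N)),
    (∀ i, ‖u i‖ = 1) ∧ (∀ j, ‖v j‖ = 1) ∧ stratBias G u v = b}

/-- Objective function of the optimization problem (Γ). -/
def gammaObj {ι κ : Type*} [Fintype ι] [Fintype κ] (G : Matrix ι κ ℝ)
    (V : Matrix κ κ ℝ) : ℝ :=
  ∑ i, Real.sqrt (∑ j, ∑ k, G i j * G i k * V j k)

/-- `V` is an optimal solution of (Γ). -/
def gammaOptimal {ι κ : Type*} [Fintype ι] [Fintype κ] (G : Matrix ι κ ℝ)
    (V : Matrix κ κ ℝ) : Prop :=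
  V.PosSemidef ∧ (∀ j, V j j = 1) ∧
    ∀ W : Matrix κ κ ℝ, W.PosSemidef → (∀ j, W j j = 1) → gammaObj G W ≤ gammaObj G V

/-- `c` is the family of marginal row biases of `G`. -/
def isMarginalRowBiases {ι κ : Type*} [Fintype ι] [Fintype κ] (G : Matrix ι κ ℝ)
    (c : ι → ℝ) : Prop :=
  (∀ i, 0 ≤ c i) ∧
  ∀ (N : ℕ) (u : ι → EuclideanSpace ℝ (Fin N)) (v : κ → EuclideanSpace ℝ (Fin N)),
    (∀ i, ‖u i‖ = 1) → (∀ j, ‖v j‖ = 1) → stratBias G u v = quantumBias G →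
    ∀ i, ∑ j, G i j * ⟪u i, v j⟫ = c i

/-- `d` is the family of marginal column biases of `G`. -/
def isMarginalColBiases {ι κ : Type*} [Fintype ι] [Fintype κ] (G : Matrix ι κ ℝ)
    (d : κ → ℝ) : Prop :=
  (∀ j, 0 ≤ d j) ∧
  ∀ (N : ℕ) (u : ι → EuclideanSpace ℝ (Fin N)) (v : κ → EuclideanSpace ℝ (Fin N)),
    (∀ i, ‖u i‖ = 1) → (∀ j, ‖v j‖ = 1) → stratBias G u v = quantumBias G →
    ∀ j, ∑ i, G i j * ⟪u i, v j⟫ = d j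

/-- Hermitian inner product on `ι → ℂ`. -/
def cinner {ι : Type*} [Fintype ι] (x y : ι → ℂ) : ℂ := ∑ i, star (x i) * y i

/-- Hilbert space norm on `ι → ℂ`. -/
def cnorm {ι : Type*} [Fintype ι] (x : ι → ℂ) : ℝ := Real.sqrt (∑ i, ‖x i‖ ^ 2)

/-- Frobenius norm of a complex matrix. -/
def frobNorm {ι κ : Type*} [Fintype ι] [Fintype κ] (M : Matrix ι κ ℂ) : ℝ :=
  Real.sqrt (∑ i, ∑ j, ‖M i j‖ ^ 2)

/-- Operator norm of a complex square matrix. -/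
def opNorm {ι : Type*} [Fintype ι] [DecidableEq ι] (M : Matrix ι ι ℂ) : ℝ :=
  ‖Matrix.toEuclideanCLM (𝕜 := ℂ) M‖

/-- Bias of a quantum strategy. -/
def qStratBias {ι κ : Type*} [Fintype ι] [Fintype κ] {d₁ d₂ : ℕ} (G : Matrix ι κ ℝ)
    (A : ι → Matrix (Fin d₁) (Fin d₁) ℂ) (B : κ → Matrix (Fin d₂) (Fin d₂) ℂ)
    (ψ : Fin d₁ × Fin d₂ → ℂ) : ℂ :=
  ∑ i, ∑ j, (G i j : ℂ) * cinner ψ ((A i ⊗ₖ B j).mulVec ψ)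

/-- Nondegeneracy of a quantum strategy. -/
def Nondegenerate {ι κ : Type*} {d₁ d₂ : ℕ}
    (A : ι → Matrix (Fin d₁) (Fin d₁) ℂ) (B : κ → Matrix (Fin d₂) (Fin d₂) ℂ)
    (ψ : Fin d₁ × Fin d₂ → ℂ) : Prop :=
  (¬ ∃ P : Matrix (Fin d₁) (Fin d₁) ℂ, P ≠ 1 ∧ P.IsHermitian ∧ P * P = P ∧
      (∀ i, P * A i = A i * P) ∧ (P ⊗ₖ (1 : Matrix (Fin d₂) (Fin d₂) ℂ)).mulVec ψ = ψ) ∧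
  (¬ ∃ Q : Matrix (Fin d₂) (Fin d₂) ℂ, Q ≠ 1 ∧ Q.IsHermitian ∧ Q * Q = Q ∧
      (∀ j, Q * B j = B j * Q) ∧ ((1 : Matrix (Fin d₁) (Fin d₁) ℂ) ⊗ₖ Q).mulVec ψ = ψ)

/-- Row index type for the XOR game associated to a graph `H`: one ordered edge
`(i,j)` with `i < j` together with a boolean choosing one of the two rows. -/
def GraphRow {v : ℕ} (H : SimpleGraph (Fin v)) [DecidableRel H.Adj] : Type :=
  {p : Fin v × Fin v // p.1 < p.2 ∧ H.Adj p.1 p.2} × Bool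

instance {v : ℕ} (H : SimpleGraph (Fin v)) [DecidableRel H.Adj] :
    Fintype (GraphRow H) := by
  unfold GraphRow; infer_instance

/-- The XOR game `A_H` associated to a graph `H` with `e` edges: for each edge
`{i,j}` (`i < j`), one row with entries `1/(4e)` at `i` and `−1/(4e)` at `j`, and
one row with entries `1/(4e)` at both `i` and `j`. -/
def graphGame {v : ℕ} (H : SimpleGraph (Fin v)) [DecidableRel H.Adj] (e : ℕ) :
    Matrix (GraphRow H) (Fin v) ℝ :=
  fun r k =>
    if k = r.1.1.1 then 1 / (4 * e)
    else if k = r.1.1.2 then (if r.2 then 1 / (4 * e) else -(1 / (4 * e)))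
    else 0


/-- The edges of `H`, as pairs of vertices in increasing order. -/
abbrev OrderedEdge {v : ℕ} (H : SimpleGraph (Fin v)) : Type :=
  {p : Fin v × Fin v // p.1 < p.2 ∧ H.Adj p.1 p.2}

lemma card_orderedEdge {v : ℕ} (H : SimpleGraph (Fin v)) [DecidableRel H.Adj] :
    Fintype.card (OrderedEdge H) = H.edgeFinset.card := by
  rw [← Finset.card_univ]
  refine Finset.card_bij (fun p _ => s(p.1.1, p.1.2)) ?_ ?_ ?_
  · rintro ⟨⟨a, b⟩, hlt, hadj⟩ _
    simpa using hadj
  · rintro ⟨⟨a, b⟩, hab, _⟩ _ ⟨⟨c, d⟩, hcd, _⟩ _ heq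
    rcases Sym2.eq_iff.mp heq with ⟨h₁, h₂⟩ | ⟨h₁, h₂⟩ <;> dsimp only at *
    · subst h₁ h₂; rfl
    · subst h₁ h₂; exact absurd hab hcd.asymm
  · intro z hz
    induction z using Sym2.ind with
    | _ a b =>
      have hadj : H.Adj a b := by simpa using hz
      rcases lt_or_gt_of_ne hadj.ne with h | h
      · exact ⟨⟨(a, b), h, hadj⟩, Finset.mem_univ _, rfl⟩
      · exact ⟨⟨(b, a), h, hadj.symm⟩, Finset.mem_univ _, Sym2.eq_swap⟩

lemma sum_graphRow {v : ℕ} (H : SimpleGraph (Fin v)) [DecidableRel H.Adj]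
    (f : GraphRow H → ℝ) :
    ∑ r, f r = ∑ p : OrderedEdge H, (f (p, true) + f (p, false)) := by
  have h : ∑ r, f r = ∑ q : OrderedEdge H × Bool, f q :=
    Fintype.sum_equiv (Equiv.refl (OrderedEdge H × Bool)) _ _ fun _ => rfl
  exact h.trans ((Fintype.sum_prod_type fun q : OrderedEdge H × Bool => f q).trans
    (Finset.sum_congr rfl fun p _ => Fintype.sum_bool fun s => f (p, s)))

lemma sum_graphGame_mul {v : ℕ} (H : SimpleGraph (Fin v)) [DecidableRel H.Adj] (e : ℕ)
    (r : GraphRow H) (f : Fin v → ℝ) :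
    ∑ k, graphGame H e r k * f k =
      1 / (4 * e) * (f r.1.1.1 + (if r.2 then 1 else -1) * f r.1.1.2) := by
  have hne : r.1.1.2 ≠ r.1.1.1 := r.1.2.1.ne'
  rw [Finset.sum_eq_add r.1.1.1 r.1.1.2 hne.symm]
  · simp only [graphGame, if_true, if_neg hne]
    split_ifs <;> ring
  · rintro k - ⟨h₁, h₂⟩
    simp [graphGame, h₁, h₂]
  · simp
  · simp

lemma norm_add_add_norm_sub_le {E : Type*} [NormedAddCommGroup E] [InnerProductSpace ℝ E]
    {a b : E} (ha : ‖a‖ = 1) (hb : ‖b‖ = 1) : ‖a + b‖ + ‖a - b‖ ≤ 2 * √2 := by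
  have h := parallelogram_law_with_norm ℝ a b
  rw [ha, hb] at h
  refine le_of_sq_le_sq ?_ (by positivity)
  nlinarith [sq_nonneg (‖a + b‖ - ‖a - b‖), Real.sq_sqrt (show (0 : ℝ) ≤ 2 by norm_num)]

lemma stratBias_graphGame_le {v : ℕ} (H : SimpleGraph (Fin v)) [DecidableRel H.Adj]
    (he : 1 ≤ H.edgeFinset.card) {N : ℕ}
    {u : GraphRow H → EuclideanSpace ℝ (Fin N)} {w : Fin v → EuclideanSpace ℝ (Fin N)}
    (hu : ∀ r, ‖u r‖ = 1) (hw : ∀ k, ‖w k‖ = 1) :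
    stratBias (graphGame H H.edgeFinset.card) u w ≤ 1 / √2 := by
  have he' : (0 : ℝ) < H.edgeFinset.card := by exact_mod_cast he
  simp only [stratBias, sum_graphGame_mul]
  rw [sum_graphRow]
  calc _ ≤ ∑ p : OrderedEdge H, 1 / (4 * (H.edgeFinset.card : ℝ)) * (2 * √2) := by
        refine Finset.sum_le_sum fun p _ => ?_
        rw [← mul_add]
        refine mul_le_mul_of_nonneg_left ?_ (by positivity)
        refine le_trans ?_ (norm_add_add_norm_sub_le (hw p.1.1) (hw p.1.2))
        have h₁ := real_inner_le_norm (u (p, true)) (w p.1.1 + w p.1.2)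
        have h₂ := real_inner_le_norm (u (p, false)) (w p.1.1 - w p.1.2)
        have hu₁ : ‖u (p, true)‖ = 1 := hu _
        have hu₂ : ‖u (p, false)‖ = 1 := hu _
        rw [hu₁, one_mul, inner_add_right] at h₁
        rw [hu₂, one_mul, inner_sub_right] at h₂
        simp only [if_true, Bool.false_eq_true, if_false]
        linarith
    _ = 1 / √2 := by
        rw [Finset.sum_const, Finset.card_univ, card_orderedEdge, nsmul_eq_mul]
        field_simp
        norm_num

/-- The optimal row vectors against the standard basis: `(e_i ± e_j) / √2`. -/
def graphRowVector {v : ℕ} {H : SimpleGraph (Fin v)} [DecidableRel H.Adj]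
    (r : GraphRow H) : EuclideanSpace ℝ (Fin v) :=
  (1 / √2) • (EuclideanSpace.single r.1.1.1 (1 : ℝ) +
    (if r.2 then (1 : ℝ) else -1) • EuclideanSpace.single r.1.1.2 (1 : ℝ))

lemma norm_graphRowVector {v : ℕ} {H : SimpleGraph (Fin v)} [DecidableRel H.Adj]
    (r : GraphRow H) : ‖graphRowVector r‖ = 1 := by
  have hne : r.1.1.1 ≠ r.1.1.2 := r.1.2.1.ne
  have horth : ⟪EuclideanSpace.single r.1.1.1 (1 : ℝ),
      (if r.2 then (1 : ℝ) else -1) • EuclideanSpace.single r.1.1.2 (1 : ℝ)⟫ = 0 := by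
    split_ifs <;> simp [EuclideanSpace.inner_single_left, hne]
  have hsq := norm_add_sq_eq_norm_sq_add_norm_sq_real horth
  have hsign : ‖(if r.2 then (1 : ℝ) else -1)‖ = 1 := by split_ifs <;> simp
  rw [norm_smul, hsign, PiLp.norm_single, PiLp.norm_single, norm_one, one_mul,
    one_mul, one_add_one_eq_two] at hsq
  rw [graphRowVector, norm_smul, ← Real.sqrt_mul_self (norm_nonneg (_ + _)), hsq]
  rw [Real.norm_of_nonneg (by positivity)]
  field_simp

lemma row_bias_graphRowVector {v : ℕ} (H : SimpleGraph (Fin v)) [DecidableRel H.Adj]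
    (r : GraphRow H) :
    ∑ k, graphGame H H.edgeFinset.card r k *
        ⟪graphRowVector r, EuclideanSpace.single k (1 : ℝ)⟫ =
      1 / (2 * √2 * H.edgeFinset.card) := by
  have hne : r.1.1.1 ≠ r.1.1.2 := r.1.2.1.ne
  have h₁ : ⟪graphRowVector r, EuclideanSpace.single r.1.1.1 (1 : ℝ)⟫ = 1 / √2 := by
    simp only [graphRowVector]
    split_ifs <;> simp [inner_add_left, inner_smul_left, EuclideanSpace.inner_single_left, hne]
  have h₂ : ⟪graphRowVector r, EuclideanSpace.single r.1.1.2 (1 : ℝ)⟫ =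
      1 / √2 * (if r.2 then 1 else -1) := by
    simp only [graphRowVector]
    split_ifs <;> simp [inner_add_left, inner_smul_left, EuclideanSpace.inner_single_left, hne.symm]
  have hsign : (if r.2 then (1 : ℝ) else -1) * (if r.2 then 1 else -1) = 1 := by
    split_ifs <;> norm_num
  rw [sum_graphGame_mul, h₁, h₂, mul_left_comm, hsign]
  ring

lemma stratBias_graphRowVector {v : ℕ} (H : SimpleGraph (Fin v)) [DecidableRel H.Adj]
    (he : 1 ≤ H.edgeFinset.card) :
    stratBias (graphGame H H.edgeFinset.card) graphRowVector
      (fun k => EuclideanSpace.single k (1 : ℝ)) = 1 / √2 := by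
  have he' : (0 : ℝ) < H.edgeFinset.card := by exact_mod_cast he
  simp only [stratBias, row_bias_graphRowVector]
  rw [sum_graphRow, Finset.sum_const, Finset.card_univ, card_orderedEdge, nsmul_eq_mul]
  field_simp
  norm_num

lemma quantumBias_graphGame {v : ℕ} (H : SimpleGraph (Fin v)) [DecidableRel H.Adj]
    (he : 1 ≤ H.edgeFinset.card) :
    quantumBias (graphGame H H.edgeFinset.card) = 1 / √2 := by
  refine IsGreatest.csSup_eq ⟨⟨v, graphRowVector, fun k => EuclideanSpace.single k (1 : ℝ),
    norm_graphRowVector, fun k => by simp, stratBias_graphRowVector H he⟩, ?_⟩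
  rintro b ⟨N, u, w, hu, hw, rfl⟩
  exact stratBias_graphGame_le H he hu hw

lemma isGreatest_classicalBias_graphGame {v : ℕ} (H : SimpleGraph (Fin v))
    [DecidableRel H.Adj] (he : 1 ≤ H.edgeFinset.card) :
    IsGreatest {b : ℝ | ∃ (x : GraphRow H → ℝ) (y : Fin v → ℝ),
        (∀ i, x i = 1 ∨ x i = -1) ∧ (∀ j, y j = 1 ∨ y j = -1) ∧
        ∑ i, ∑ j, graphGame H H.edgeFinset.card i j * x i * y j = b} (1 / 2) := by
  have he' : (0 : ℝ) < H.edgeFinset.card := by exact_mod_cast he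
  have hconst : ∑ _p : OrderedEdge H, 1 / (4 * (H.edgeFinset.card : ℝ)) * 2 = 1 / 2 := by
    rw [Finset.sum_const, Finset.card_univ, card_orderedEdge, nsmul_eq_mul]
    field_simp
    norm_num
  constructor
  · refine ⟨fun _ => 1, fun _ => 1, fun _ => Or.inl rfl, fun _ => Or.inl rfl, ?_⟩
    simp only [mul_assoc, sum_graphGame_mul]
    rw [sum_graphRow, ← hconst]
    refine Finset.sum_congr rfl fun p _ => ?_
    simp only [if_true, Bool.false_eq_true, if_false]
    ring
  · rintro b ⟨x, y, hx, hy, rfl⟩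
    simp only [mul_assoc, sum_graphGame_mul]
    rw [sum_graphRow, ← hconst]
    refine Finset.sum_le_sum fun p _ => ?_
    rw [← mul_add]
    refine mul_le_mul_of_nonneg_left ?_ (by positivity)
    simp only [if_true, Bool.false_eq_true, if_false]
    rcases hx (p, true) with h₁ | h₁ <;> rcases hx (p, false) with h₂ | h₂ <;>
      rcases hy p.1.1 with h₃ | h₃ <;> rcases hy p.1.2 with h₄ | h₄ <;>
      rw [h₁, h₂, h₃, h₄] <;> norm_num

/-- for a graph game `A_H` with `e ≥ 1` edges, the quantum bias
is `1/√2`, the classical bias is `1/2`, and every marginal row bias equals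
`1/(2√2 e)`. -/
theorem graphGame_biases {v : ℕ} (H : SimpleGraph (Fin v))
    [DecidableRel H.Adj] (he : 1 ≤ H.edgeFinset.card) :
    quantumBias (graphGame H H.edgeFinset.card) = 1 / Real.sqrt 2 ∧
    IsGreatest {b : ℝ | ∃ (x : GraphRow H → ℝ) (y : Fin v → ℝ),
        (∀ i, x i = 1 ∨ x i = -1) ∧ (∀ j, y j = 1 ∨ y j = -1) ∧
        ∑ i, ∑ j, graphGame H H.edgeFinset.card i j * x i * y j = b}
      (1 / 2) ∧
    (∀ c : GraphRow H → ℝ,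
      isMarginalRowBiases (graphGame H H.edgeFinset.card) c →
      ∀ i, c i = 1 / (2 * Real.sqrt 2 * H.edgeFinset.card)) := by
  refine ⟨quantumBias_graphGame H he, isGreatest_classicalBias_graphGame H he, fun c hc r => ?_⟩
  rw [← hc.2 v graphRowVector (fun k => EuclideanSpace.single k (1 : ℝ)) norm_graphRowVector
    (fun k => by simp) ((stratBias_graphRowVector H he).trans (quantumBias_graphGame H he).symm) r]
  exact row_bias_graphRowVector H r
end
end

section
/- Let n ≥ 3. Suppose V is a real positive semidefinite matrix whose rows and columns are indexed by the nonempty subsets of {1,…,n}, with V_{S,S} = 1 for every nonempty subset S, and V_{S,T} = 0 whenever S, T are nonempty subsets for which |S|·|T| − |S∩T| is odd. Then rank V ≥ (4n − 8)/3. Equivalently, if {v_S} is a family of unit vectors in a real inner product space indexed by the nonempty subsets of {1,…,n} with ⟨v_S, v_T⟩ = 0 whenever |S|·|T| − |S∩T| is odd, then dim span{v_S} ≥ (4n − 8)/3. -/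
open scoped BigOperators RealInnerProductSpace
open Matrix Kronecker

noncomputable section

section TripleRepresentation

variable {ι E : Type*} [DecidableEq ι] [NormedAddCommGroup E] [InnerProductSpace ℝ E]

/-- If unit vectors attached to the triples of `R` are orthogonal whenever the triples share two
points, and each of them satisfies Parseval's identity for unit vectors attached to its points, then `R` has at most five elements. -/
theorem card_le_five_of_triples_in_span (e : ι → E) (v : Finset ι → E)
    (he : ∀ i, ‖e i‖ = 1) (hv : ∀ S, S.card = 3 → ‖v S‖ = 1)
    (hvv : ∀ S T, S.card = 3 → T.card = 3 → (S ∩ T).card = 2 → ⟪v S, v T⟫ = 0)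
    (R : Finset ι)
    (hR : ∀ S ⊆ R, S.card = 3 → ∑ i ∈ S, ⟪v S, e i⟫ ^ 2 = 1) : R.card ≤ 5 := by
  by_contra! hcard
  let D : ι → ι → ι → Prop := fun a b c => a ≠ b ∧ a ≠ c ∧ b ≠ c
  let f : ι → ι → ι → ℝ := fun a b c => if D a b c then ⟪v {a, b, c}, e a⟫ ^ 2 else 0
  let d : ι → ι → ι → ℝ := fun a b c => if D a b c then 1 else 0
  have cyc : ∀ g : ι → ι → ι → ℝ,
      ∑ a ∈ R, ∑ b ∈ R, ∑ c ∈ R, g b c a = ∑ a ∈ R, ∑ b ∈ R, ∑ c ∈ R, g a b c := by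
    intro g
    rw [Finset.sum_comm]
    exact Finset.sum_congr rfl fun b _ => Finset.sum_comm
  have hsum : ∀ a ∈ R, ∀ b ∈ R, ∀ c ∈ R, f a b c + f b c a + f c a b = d a b c := by
    intro a ha b hb c hc
    by_cases h : D a b c
    · obtain ⟨hab, hac, hbc⟩ := h
      have h1 : ({b, c, a} : Finset ι) = {a, b, c} := by
        clear * -; grind
      have h2 : ({c, a, b} : Finset ι) = {a, b, c} := by
        clear * -; grind
      have := hR {a, b, c} (by simp [Finset.insert_subset_iff, *])
        (Finset.card_eq_three.2 ⟨a, b, c, hab, hac, hbc, rfl⟩)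
      rw [Finset.sum_insert (by simp [hab, hac]), Finset.sum_insert (by simp [hbc]),
        Finset.sum_singleton] at this
      simp only [f, d, D, h1, h2]
      simp [hab, hac, hbc, hab.symm, hac.symm, hbc.symm]
      linarith
    · have h1 : ¬ D b c a := fun h' => h ⟨h'.2.1.symm, h'.2.2.symm, h'.1⟩
      have h2 : ¬ D c a b := fun h' => h ⟨h'.2.2, h'.1.symm, h'.2.1.symm⟩
      simp [f, d, h, h1, h2]
  have htotal : 3 * ∑ a ∈ R, ∑ b ∈ R, ∑ c ∈ R, f a b c
      = ∑ a ∈ R, ∑ b ∈ R, ∑ c ∈ R, d a b c := by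
    have h1 := cyc f
    have h2 := cyc fun a b c => f b c a
    rw [← Finset.sum_congr rfl fun a ha => Finset.sum_congr rfl fun b hb =>
      Finset.sum_congr rfl fun c hc => hsum a ha b hb c hc]
    simp only [Finset.sum_add_distrib]
    linarith
  have hfilter : ∀ a b, a ≠ b → R.filter (fun c => D a b c) = (R.erase a).erase b := by
    intro a b hab
    ext c
    simp only [D, Finset.mem_filter, Finset.mem_erase]
    clear * - hab
    grind
  have hpair : ∀ a ∈ R, ∀ b ∈ R, a ≠ b → ∑ c ∈ R, d a b c = (R.card : ℝ) - 2 := by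
    intro a ha b hb hab
    simp only [d, Finset.sum_boole, hfilter a b hab]
    rw [Finset.card_erase_of_mem (by simp [hb, hab.symm]), Finset.card_erase_of_mem ha, Nat.sub_sub,
      Nat.cast_sub (by omega)]
    norm_num
  have hbessel : ∀ a ∈ R, ∀ b ∈ R, 4 * ∑ c ∈ R, f a b c ≤ ∑ c ∈ R, d a b c := by
    intro a ha b hb
    by_cases hab : a = b
    · simp [f, d, D, hab]
    have hcard3 : ∀ c ∈ (R.erase a).erase b, ({a, b, c} : Finset ι).card = 3 := fun c hc => by
      simp only [Finset.mem_erase] at hc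
      exact Finset.card_eq_three.2 ⟨a, b, c, hab, hc.2.1.symm, hc.1.symm, rfl⟩
    have hon : Orthonormal ℝ fun c : {c // c ∈ (R.erase a).erase b} => v {a, b, c.1} := by
      refine ⟨fun c => hv _ (hcard3 _ c.2), fun c c' hcc => ?_⟩
      have hne : c.1 ≠ c'.1 := fun h => hcc (Subtype.ext h)
      refine hvv _ _ (hcard3 _ c.2) (hcard3 _ c'.2) ?_
      have hc := c.2
      have hc' := c'.2
      rw [show ({a, b, c.1} ∩ {a, b, c'.1} : Finset ι) = {a, b} by
        clear * - hc hc' hne; grind]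
      exact Finset.card_pair hab
    have hle := hon.sum_inner_products_le (x := e a) (s := Finset.univ)
    have heq : ∑ c ∈ R, f a b c
        = ∑ c : {c // c ∈ (R.erase a).erase b}, ‖⟪v {a, b, c.1}, e a⟫‖ ^ 2 := by
      rw [Finset.sum_coe_sort ((R.erase a).erase b) fun c => ‖⟪v {a, b, c}, e a⟫‖ ^ 2]
      simp only [f, ← Finset.sum_filter, hfilter a b hab, Real.norm_eq_abs, sq_abs]
    rw [hpair a ha b hb hab, heq]
    rw [he] at hle
    have : (6 : ℝ) ≤ R.card := by exact_mod_cast hcard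
    linarith
  have hle : 4 * ∑ a ∈ R, ∑ b ∈ R, ∑ c ∈ R, f a b c
      ≤ ∑ a ∈ R, ∑ b ∈ R, ∑ c ∈ R, d a b c := by
    simp only [Finset.mul_sum (s := R) (a := (4 : ℝ))]
    refine Finset.sum_le_sum fun a ha => Finset.sum_le_sum fun b hb => ?_
    rw [← Finset.mul_sum]
    exact hbessel a ha b hb
  have hd : ∀ a b c, 0 ≤ d a b c := fun a b c => by simp only [d]; split_ifs <;> norm_num
  have hpos : 0 < ∑ a ∈ R, ∑ b ∈ R, ∑ c ∈ R, d a b c := by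
    obtain ⟨a, ha, b, hb, hab⟩ := Finset.one_lt_card.1 (by omega : 1 < R.card)
    refine Finset.sum_pos' (fun a _ => Finset.sum_nonneg fun b _ => Finset.sum_nonneg
      fun c _ => hd a b c) ⟨a, ha, Finset.sum_pos' (fun b _ => Finset.sum_nonneg
      fun c _ => hd a b c) ⟨b, hb, ?_⟩⟩
    rw [hpair a ha b hb hab]
    have : (6 : ℝ) ≤ R.card := by exact_mod_cast hcard
    linarith
  linarith

/-- If every set of at least six points contains a triple with property `p`, then `m` pairwise
disjoint such triples exist as soon as there are `3 * m + 3` points. -/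
theorem exists_disjoint_triples [Fintype ι] (p : Finset ι → Prop)
    (hp : ∀ R : Finset ι, 6 ≤ R.card → ∃ S ⊆ R, S.card = 3 ∧ p S) (m : ℕ)
    (hm : 3 * m + 3 ≤ Fintype.card ι) :
    ∃ P : Finset (Finset ι), P.card = m ∧ (∀ S ∈ P, S.card = 3 ∧ p S) ∧
      ∀ S ∈ P, ∀ T ∈ P, S ≠ T → Disjoint S T := by
  induction m with
  | zero => exact ⟨∅, by simp⟩
  | succ m ih =>
    obtain ⟨P, hPcard, hP, hdisj⟩ := ih (by omega)
    have hunion : (P.biUnion id).card ≤ P.card * 3 :=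
      Finset.card_biUnion_le_card_mul P id 3 fun S hS => (hP S hS).1.le
    obtain ⟨S, hSR, hS, hpS⟩ := hp (P.biUnion id)ᶜ (by rw [Finset.card_compl]; omega)
    have hST : ∀ T ∈ P, Disjoint S T := fun T hT => by
      refine Finset.disjoint_left.2 fun i hiS hiT => ?_
      exact Finset.mem_compl.1 (hSR hiS) (Finset.mem_biUnion.2 ⟨T, hT, hiT⟩)
    have hSP : S ∉ P := fun h => by
      have := Finset.disjoint_self_iff_empty S |>.1 (hST S h)
      simp [this] at hS
    refine ⟨insert S P, by rw [Finset.card_insert_of_notMem hSP, hPcard], ?_, ?_⟩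
    · simpa [hS, hpS] using hP
    · intro A hA B hB hAB
      rcases Finset.mem_insert.1 hA with rfl | hA' <;>
        rcases Finset.mem_insert.1 hB with rfl | hB'
      · exact absurd rfl hAB
      · exact hST B hB'
      · exact (hST A hA').symm
      · exact hdisj A hA' B hB' hAB

/-- A family of unit vectors attached to the points and triples of an `n`-element set, orthogonal
at distinct points, at a triple and a point outside it, and at triples sharing an even number of
points other than all of them, spans a space of dimension at least `n + (n - 3) / 3`. -/
theorem card_add_le_finrank_of_triples [Fintype ι] (e : ι → E) (v : Finset ι → E)
    (he : Orthonormal ℝ e) (hv : ∀ S, S.card = 3 → ‖v S‖ = 1)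
    (hve : ∀ S, S.card = 3 → ∀ i ∉ S, ⟪v S, e i⟫ = 0)
    (hvv : ∀ S T, S.card = 3 → T.card = 3 → Even (S ∩ T).card → ⟪v S, v T⟫ = 0)
    (m : ℕ) (hm : 3 * m + 3 ≤ Fintype.card ι) (W : Submodule ℝ E) [FiniteDimensional ℝ W]
    (heW : ∀ i, e i ∈ W) (hvW : ∀ S, S.card = 3 → v S ∈ W) :
    Fintype.card ι + m ≤ Module.finrank ℝ W := by
  let w : Finset ι → E := fun S => v S - ∑ i, ⟪v S, e i⟫ • e i
  have hwe : ∀ S i, ⟪e i, w S⟫ = 0 := fun S i => by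
    rw [inner_sub_right, he.inner_right_fintype, real_inner_comm, sub_self]
  have hww : ∀ S T, ⟪w S, w T⟫ = ⟪v S, v T⟫ - ∑ i, ⟪v S, e i⟫ * ⟪v T, e i⟫ := fun S T => by
    have : ⟪w S, w T⟫ = ⟪v S, w T⟫ := by
      conv_lhs => rw [show w S = v S - ∑ i, ⟪v S, e i⟫ • e i from rfl]
      rw [inner_sub_left, sum_inner]
      simp [real_inner_smul_left, hwe]
    rw [this, inner_sub_right, inner_sum]
    simp only [real_inner_smul_right, mul_comm]
  obtain ⟨P, hPcard, hP, hdisj⟩ := exists_disjoint_triples (fun S => w S ≠ 0) (by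
    intro R hR
    by_contra! hcon
    have := card_le_five_of_triples_in_span e v he.1 hv
      (fun S T hS hT h => hvv S T hS hT (by rw [h]; decide)) R (fun S hSR hS => by
        have h0 := hww S S
        rw [hcon S hSR hS, inner_zero_left, real_inner_self_eq_norm_sq, hv S hS] at h0
        rw [Finset.sum_subset (Finset.subset_univ S) fun i _ hi => by rw [hve S hS i hi]; norm_num]
        simp only [← sq] at h0
        linarith)
    omega) m hm
  let u : ι ⊕ P → W := Sum.elim (fun i => ⟨e i, heW i⟩) fun S =>
    ⟨w S, W.sub_mem (hvW _ (hP _ S.2).1) (W.sum_mem fun i _ => W.smul_mem _ (heW i))⟩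
  have hu : LinearIndependent ℝ u := by
    refine linearIndependent_of_ne_zero_of_inner_eq_zero (𝕜 := ℝ) ?_ ?_
    · rintro (i | S) h
      · exact he.ne_zero i (congrArg Subtype.val h)
      · exact (hP S.1 S.2).2 (congrArg Subtype.val h)
    · rintro (i | S) (j | T) h
      · exact he.2 fun hij => h (congrArg Sum.inl hij)
      · exact hwe T i
      · exact (real_inner_comm _ _).trans (hwe S j)
      · have hdST := hdisj S S.2 T T.2 fun hST => h (congrArg Sum.inr (Subtype.ext hST))
        refine (hww S T).trans ?_
        rw [hvv S T (hP S S.2).1 (hP T T.2).1 (by simp [Finset.disjoint_iff_inter_eq_empty.1 hdST]),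
          Finset.sum_eq_zero, sub_zero]
        intro i _
        by_cases hi : i ∈ S.1
        · rw [hve T (hP T T.2).1 i (Finset.disjoint_left.1 hdST hi), mul_zero]
        · rw [hve S (hP S S.2).1 i hi, zero_mul]
  simpa [hPcard] using hu.fintype_card_le_finrank

end TripleRepresentation

/-- Unit vectors indexed by the nonempty subsets of an `n`-element set, orthogonal whenever the
corresponding products of Clifford generators anticommute, span a space of dimension at least
`(4 * n - 8) / 3`. -/
theorem le_finrank_span_of_anticommute_orthogonal {E : Type*} [NormedAddCommGroup E]
    [InnerProductSpace ℝ E] (n : ℕ) (hn : 3 ≤ n)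
    (w : {S : Finset (Fin n) // S.Nonempty} → E) (hw : ∀ S, ‖w S‖ = 1)
    (hww : ∀ S T : {S : Finset (Fin n) // S.Nonempty},
      Odd (S.1.card * T.1.card - (S.1 ∩ T.1).card) → ⟪w S, w T⟫ = 0) :
    (4 * (n : ℝ) - 8) / 3 ≤ (Module.finrank ℝ (Submodule.span ℝ (Set.range w)) : ℝ) := by
  have hne : ∀ S : Finset (Fin n), S.card = 3 → S.Nonempty := fun S hS =>
    Finset.card_pos.1 (by omega)
  let e : Fin n → E := fun i => w ⟨{i}, Finset.singleton_nonempty i⟩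
  let v : Finset (Fin n) → E := fun S => if h : S.Nonempty then w ⟨S, h⟩ else 0
  have hvw : ∀ S (hS : S.card = 3), v S = w ⟨S, hne S hS⟩ := fun S hS => dif_pos (hne S hS)
  have : FiniteDimensional ℝ (Submodule.span ℝ (Set.range w)) :=
    FiniteDimensional.span_of_finite ℝ (Set.finite_range w)
  have key := card_add_le_finrank_of_triples e v
    ⟨fun i => hw _, fun i j hij => hww _ _ (by simp [hij])⟩
    (fun S hS => by rw [hvw S hS]; exact hw _)
    (fun S hS i hi => by
      rw [hvw S hS]
      exact hww _ _ (by simp [hS, hi]; decide))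
    (fun S T hS hT h => by
      rw [hvw S hS, hvw T hT]
      refine hww _ _ ?_
      have : (S ∩ T).card ≤ 3 := hS ▸ Finset.card_le_card Finset.inter_subset_left
      simp only [hS, hT]
      exact Nat.Odd.sub_even (by omega) (by decide) h)
    ((n - 3) / 3) (by rw [Fintype.card_fin]; omega) (Submodule.span ℝ (Set.range w))
    (fun i => Submodule.subset_span ⟨_, rfl⟩)
    (fun S hS => by rw [hvw S hS]; exact Submodule.subset_span ⟨_, rfl⟩)
  rw [Fintype.card_fin] at key
  have h3 : 4 * n ≤ 3 * Module.finrank ℝ (Submodule.span ℝ (Set.range w)) + 8 := by omega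
  have h3' : 4 * (n : ℝ) ≤ 3 * (Module.finrank ℝ (Submodule.span ℝ (Set.range w)) : ℝ) + 8 := by
    exact_mod_cast h3
  linarith

open scoped MatrixOrder Matrix.Norms.L2Operator in
/-- A real positive semidefinite matrix is the Gram matrix of vectors spanning a space of dimension
its rank. -/
theorem Matrix.PosSemidef.exists_gram_finrank_span_eq_rank {κ : Type*} [Fintype κ]
    {V : Matrix κ κ ℝ} (hV : V.PosSemidef) :
    ∃ w : κ → EuclideanSpace ℝ κ, (∀ i j, ⟪w i, w j⟫ = V i j) ∧
      Module.finrank ℝ (Submodule.span ℝ (Set.range w)) = V.rank := by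
  classical
  obtain ⟨B, rfl⟩ := CStarAlgebra.nonneg_iff_eq_star_mul_self.mp hV.nonneg
  rw [Matrix.star_eq_conjTranspose]
  refine ⟨fun i => WithLp.toLp 2 (B.col i), fun i j => ?_, ?_⟩
  · simp [PiLp.inner_apply, Matrix.mul_apply, Matrix.col, mul_comm]
  · rw [Matrix.rank_conjTranspose_mul_self, Matrix.rank_eq_finrank_span_cols,
      ← LinearEquiv.finrank_map_eq (WithLp.linearEquiv 2 ℝ (κ → ℝ)).symm, Submodule.map_span,
      ← Set.range_comp]
    rfl

/-- a PSD matrix indexed by nonempty subsets of `{1,…,n}`,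
with unit diagonal and vanishing entries at "anticommuting" pairs (those with
`|S||T| − |S∩T|` odd), has rank at least `(4n−8)/3`; equivalently, unit vectors
with these orthogonality relations span a space of dimension at least
`(4n−8)/3`. -/
theorem CL_game_rank_lower_bound (n : ℕ) (hn : 3 ≤ n) :
    (∀ V : Matrix {S : Finset (Fin n) // S.Nonempty}
        {S : Finset (Fin n) // S.Nonempty} ℝ,
      V.PosSemidef → (∀ S, V S S = 1) →
      (∀ S T : {S : Finset (Fin n) // S.Nonempty},
        Odd (S.1.card * T.1.card - (S.1 ∩ T.1).card) → V S T = 0) →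
      (4 * (n : ℝ) - 8) / 3 ≤ (V.rank : ℝ)) ∧
    (∀ (E : Type) [NormedAddCommGroup E] [InnerProductSpace ℝ E],
      ∀ w : {S : Finset (Fin n) // S.Nonempty} → E,
      (∀ S, ‖w S‖ = 1) →
      (∀ S T : {S : Finset (Fin n) // S.Nonempty},
        Odd (S.1.card * T.1.card - (S.1 ∩ T.1).card) → ⟪w S, w T⟫ = 0) →
      (4 * (n : ℝ) - 8) / 3 ≤ (Module.finrank ℝ (Submodule.span ℝ (Set.range w)) : ℝ)) := by
  have key := fun (E : Type) [NormedAddCommGroup E] [InnerProductSpace ℝ E] =>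
    le_finrank_span_of_anticommute_orthogonal (E := E) n hn
  refine ⟨fun V hV hdiag horth => ?_, fun E _ _ => key E⟩
  obtain ⟨w, hw, hrank⟩ := hV.exists_gram_finrank_span_eq_rank
  rw [← hrank]
  refine key _ w (fun S => ?_) fun S T h => (hw S T).trans (horth S T h)
  have h1 : ‖w S‖ ^ 2 = 1 := by rw [← real_inner_self_eq_norm_sq, hw, hdiag]
  exact (pow_eq_one_iff_of_nonneg (norm_nonneg _) two_ne_zero).1 h1
end
end

section
/- Let n ≥ 2 and m = n(n−1)/2, and let G be the m×n XOR game whose rows are indexed by pairs (i,j) with 1 ≤ i < j ≤ n, with G_{(i,j),k} = 1/(2m) if k = i, G_{(i,j),k} = −1/(2m) if k = j, and G_{(i,j),k} = 0 otherwise. Then the n×n matrix V with V_{kk} = 1 for all k and V_{kl} = −1/(n−1) for all k ≠ l is positive semidefinite and is an optimal solution of (Γ) for G, and ε_q(G) = sqrt(n/(2(n−1))). -/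
open scoped BigOperators RealInnerProductSpace
open Matrix Kronecker

noncomputable section

/-- A symmetric function vanishing on the diagonal sums to twice its sum over ordered pairs. -/
lemma sum_sum_eq_two_mul_sum_lt {n : ℕ} (F : Fin n → Fin n → ℝ) (hsymm : ∀ i j, F i j = F j i)
    (hdiag : ∀ i, F i i = 0) :
    ∑ i, ∑ j, F i j = 2 * ∑ p : {p : Fin n × Fin n // p.1 < p.2}, F p.1.1 p.1.2 := by
  have hlt : ∑ p : {p : Fin n × Fin n // p.1 < p.2}, F p.1.1 p.1.2
      = ∑ i, ∑ j, if i < j then F i j else 0 := by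
    rw [← Fintype.sum_prod_type' (f := fun i j => if i < j then F i j else 0),
      ← Finset.sum_filter]
    exact (Finset.sum_subtype _ (by simp) fun p : Fin n × Fin n => F p.1 p.2).symm
  have hgt : ∑ i, ∑ j, (if j < i then F i j else 0) = ∑ i, ∑ j, if i < j then F i j else 0 := by
    rw [Finset.sum_comm]
    simp only [hsymm]
  have hsplit : ∀ i j, F i j = (if i < j then F i j else 0) + if j < i then F i j else 0 := by
    intro i j
    rcases lt_trichotomy i j with h | rfl | h
    · simp [h, h.le]
    · simp [hdiag]
    · simp [h, h.le]
  rw [hlt, two_mul]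
  nth_rewrite 2 [← hgt]
  simp only [← Finset.sum_add_distrib, ← hsplit]

lemma two_mul_card_lt (n : ℕ) :
    2 * (Fintype.card {p : Fin n × Fin n // p.1 < p.2} : ℝ) = n * (n - 1) := by
  have h := sum_sum_eq_two_mul_sum_lt (n := n) (fun i j => if i = j then 0 else 1)
    (by intro i j; simp [eq_comm]) (by simp)
  have hone : ∀ p : {p : Fin n × Fin n // p.1 < p.2},
      (if p.1.1 = p.1.2 then (0 : ℝ) else 1) = 1 := fun p => if_neg p.2.ne
  have hcompl : ∀ i j : Fin n, (if i = j then (0 : ℝ) else 1) = 1 - if i = j then 1 else 0 := by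
    intro i j
    split_ifs <;> simp
  simp only [hone] at h
  simp only [hcompl] at h
  simp [Finset.sum_sub_distrib] at h
  linarith

lemma Matrix.PosSemidef.sum_sum_nonneg {κ : Type*} [Fintype κ] {W : Matrix κ κ ℝ}
    (hW : W.PosSemidef) : 0 ≤ ∑ i, ∑ j, W i j := by
  simpa [dotProduct, mulVec] using hW.dotProduct_mulVec_nonneg (fun _ => (1 : ℝ))

lemma sum_ite_pair {n : ℕ} {a b : Fin n} (hab : a ≠ b) (c : ℝ) (x : Fin n → ℝ) :
    ∑ k, (if k = a then c else if k = b then -c else 0) * x k = c * (x a - x b) := by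
  have h : ∀ k, (if k = a then c else if k = b then -c else 0) * x k
      = (if k = a then c * x k else 0) - if k = b then c * x k else 0 := by
    intro k
    by_cases ha : k = a
    · subst ha; simp [hab]
    · by_cases hb : k = b <;> simp [ha, hb, hab.symm]
  simp only [h, Finset.sum_sub_distrib, Finset.sum_ite_eq', Finset.mem_univ, if_true]
  ring

lemma norm_sum_smul_sq {κ : Type*} [Fintype κ] {N : ℕ} (g : κ → ℝ)
    (v : κ → EuclideanSpace ℝ (Fin N)) :
    ‖∑ j, g j • v j‖ ^ 2 = ∑ j, ∑ k, g j * g k * ⟪v j, v k⟫ := by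
  rw [← real_inner_self_eq_norm_sq, sum_inner]
  simp only [inner_sum, real_inner_smul_left, real_inner_smul_right]
  exact Finset.sum_congr rfl fun j _ => Finset.sum_congr rfl fun k _ => by ring

lemma gammaObj_gram {ι κ : Type*} [Fintype ι] [Fintype κ] (G : Matrix ι κ ℝ) {N : ℕ}
    (v : κ → EuclideanSpace ℝ (Fin N)) :
    gammaObj G (Matrix.of fun j k => ⟪v j, v k⟫) = ∑ i, ‖∑ j, G i j • v j‖ := by
  refine Finset.sum_congr rfl fun i _ => ?_
  simp only [Matrix.of_apply]
  rw [← norm_sum_smul_sq, Real.sqrt_sq (norm_nonneg _)]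

lemma stratBias_eq_sum_inner {ι κ : Type*} [Fintype ι] [Fintype κ] (G : Matrix ι κ ℝ) {N : ℕ}
    (u : ι → EuclideanSpace ℝ (Fin N)) (v : κ → EuclideanSpace ℝ (Fin N)) :
    stratBias G u v = ∑ i, ⟪u i, ∑ j, G i j • v j⟫ := by
  simp only [stratBias, inner_sum, real_inner_smul_right]

lemma stratBias_le_gammaObj {ι κ : Type*} [Fintype ι] [Fintype κ] (G : Matrix ι κ ℝ) {N : ℕ}
    (u : ι → EuclideanSpace ℝ (Fin N)) (v : κ → EuclideanSpace ℝ (Fin N))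
    (hu : ∀ i, ‖u i‖ = 1) :
    stratBias G u v ≤ gammaObj G (Matrix.of fun j k => ⟪v j, v k⟫) := by
  rw [stratBias_eq_sum_inner, gammaObj_gram]
  refine Finset.sum_le_sum fun i _ => ?_
  simpa [hu i] using real_inner_le_norm (u i) (∑ j, G i j • v j)

/-- Every positive semidefinite real matrix is a Gram matrix. -/
lemma Matrix.PosSemidef.exists_gram {n : ℕ} {V : Matrix (Fin n) (Fin n) ℝ} (hV : V.PosSemidef) :
    ∃ v : Fin n → EuclideanSpace ℝ (Fin n), V = Matrix.of fun j k => ⟪v j, v k⟫ := by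
  obtain ⟨B, hB⟩ : ∃ B : Matrix (Fin n) (Fin n) ℝ, V = Bᴴ * B := by
    open scoped MatrixOrder in
    exact CStarAlgebra.nonneg_iff_eq_star_mul_self.mp hV.nonneg
  refine ⟨fun j => WithLp.toLp 2 fun i => B i j, ?_⟩
  ext j k
  simp [hB, Matrix.mul_apply, PiLp.inner_apply, mul_comm]

/-- If the combinations of the vectors by the rows of `G` do not vanish, then the value of the
Gram matrix in (Γ) is the bias of a vector strategy. -/
lemma exists_stratBias_eq_gammaObj {ι κ : Type*} [Fintype ι] [Fintype κ] (G : Matrix ι κ ℝ)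
    {N : ℕ} (v : κ → EuclideanSpace ℝ (Fin N)) (hne : ∀ i, ∑ j, G i j • v j ≠ 0) :
    ∃ u : ι → EuclideanSpace ℝ (Fin N), (∀ i, ‖u i‖ = 1) ∧
      stratBias G u v = gammaObj G (Matrix.of fun j k => ⟪v j, v k⟫) := by
  refine ⟨fun i => ‖∑ j, G i j • v j‖⁻¹ • ∑ j, G i j • v j, fun i => ?_, ?_⟩
  · rw [norm_smul, norm_inv, norm_norm, inv_mul_cancel₀ (norm_ne_zero_iff.mpr (hne i))]
  · rw [stratBias_eq_sum_inner, gammaObj_gram]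
    refine Finset.sum_congr rfl fun i _ => ?_
    have h := norm_ne_zero_iff.mpr (hne i)
    rw [real_inner_smul_left, real_inner_self_eq_norm_sq]
    field_simp

/-- The matrix of inner products of the vertices of a regular simplex is positive semidefinite. -/
lemma posSemidef_simplex {n : ℕ} (hn : 2 ≤ n) (V : Matrix (Fin n) (Fin n) ℝ)
    (hV : ∀ k l, V k l = if k = l then 1 else -(1 / ((n : ℝ) - 1))) : V.PosSemidef := by
  have hn' : (2 : ℝ) ≤ n := by exact_mod_cast hn
  have hpos : (0 : ℝ) < n - 1 := by linarith
  refine Matrix.PosSemidef.of_dotProduct_mulVec_nonneg ?_ fun x => ?_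
  · ext k l
    simp [hV, eq_comm]
  · have hV' : ∀ k l, V k l = ((n : ℝ) - 1)⁻¹ * (n * (if k = l then 1 else 0) - 1) := by
      intro k l
      rw [hV]
      split_ifs
      · field_simp
      · field_simp
        simp
    have hform : star x ⬝ᵥ V *ᵥ x = ((n : ℝ) - 1)⁻¹ * (n * ∑ k, x k ^ 2 - (∑ k, x k) ^ 2) := by
      have hrow : ∀ k, (V *ᵥ x) k = ((n : ℝ) - 1)⁻¹ * (n * x k - ∑ l, x l) := by
        intro k
        simp only [mulVec, dotProduct, hV', mul_assoc, ← Finset.mul_sum, sub_mul, one_mul,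
          Finset.sum_sub_distrib, ite_mul, zero_mul, Finset.sum_ite_eq, Finset.mem_univ, if_true]
      simp only [dotProduct, hrow, star_trivial]
      rw [sq (∑ k, x k), Finset.sum_mul, Finset.mul_sum, ← Finset.sum_sub_distrib,
        Finset.mul_sum]
      exact Finset.sum_congr rfl fun k _ => by ring
    rw [hform]
    have hcs := sq_sum_le_card_mul_sum_sq (s := Finset.univ) (f := x)
    simp only [Finset.card_univ, Fintype.card_fin] at hcs
    exact mul_nonneg (inv_nonneg.mpr hpos.le) (sub_nonneg.mpr hcs)

/-- for the `m × n` game (`m = n(n−1)/2`) whose row indexed by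
`(i,j)`, `i<j`, has entries `1/(2m)` at `i` and `−1/(2m)` at `j` (note
`2m = n(n−1)`), the matrix `V` with unit diagonal and off-diagonal entries
`−1/(n−1)` is PSD and optimal for (Γ), and `ε_q(G) = √(n/(2(n−1)))`. -/
theorem tsirelson_tight_game (n : ℕ) (hn : 2 ≤ n)
    (G : Matrix {p : Fin n × Fin n // p.1 < p.2} (Fin n) ℝ)
    (hGdef : ∀ p k, G p k =
      if k = p.1.1 then 1 / ((n : ℝ) * (n - 1))
      else if k = p.1.2 then -(1 / ((n : ℝ) * (n - 1)))
      else 0)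
    (V : Matrix (Fin n) (Fin n) ℝ)
    (hVdef : ∀ k l, V k l = if k = l then 1 else -(1 / ((n : ℝ) - 1))) :
    V.PosSemidef ∧ gammaOptimal G V ∧
    quantumBias G = Real.sqrt ((n : ℝ) / (2 * ((n : ℝ) - 1))) := by
  have hn' : (2 : ℝ) ≤ n := by exact_mod_cast hn
  have hpos : (0 : ℝ) < n - 1 := by linarith
  have hn0 : (0 : ℝ) < n := by linarith
  have hPSD := posSemidef_simplex hn V hVdef
  have hdiag : ∀ j, V j j = 1 := fun j => by simp [hVdef]
  have hcard := two_mul_card_lt n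
  have hrow : ∀ (W : Matrix (Fin n) (Fin n) ℝ) (p : {p : Fin n × Fin n // p.1 < p.2}),
      (∀ j, W j j = 1) → ∑ j, ∑ k, G p j * G p k * W j k
        = (1 / ((n : ℝ) * (n - 1))) ^ 2 * (2 - W p.1.1 p.1.2 - W p.1.2 p.1.1) := by
    intro W p hW
    simp only [hGdef, mul_assoc, ← Finset.mul_sum, sum_ite_pair p.2.ne, hW]
    ring
  have hobj : gammaObj G V = √((n : ℝ) / (2 * (n - 1))) := by
    have hterm : ∀ p : {p : Fin n × Fin n // p.1 < p.2}, √(∑ j, ∑ k, G p j * G p k * V j k)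
        = 2 / ((n : ℝ) * (n - 1)) * √((n : ℝ) / (2 * (n - 1))) := by
      intro p
      rw [hrow V p hdiag, hVdef, hVdef, if_neg p.2.ne, if_neg p.2.ne',
        ← Real.sqrt_sq (show 0 ≤ 2 / ((n : ℝ) * (n - 1)) by positivity),
        ← Real.sqrt_mul (by positivity)]
      congr 1
      field_simp
      ring
    simp only [gammaObj, hterm, Finset.sum_const, Finset.card_univ, nsmul_eq_mul]
    rw [← mul_assoc, mul_div_assoc', mul_comm _ (2 : ℝ), hcard, div_self (by positivity), one_mul]
  have hle : ∀ W : Matrix (Fin n) (Fin n) ℝ, W.PosSemidef → (∀ j, W j j = 1) →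
      gammaObj G W ≤ √((n : ℝ) / (2 * (n - 1))) := by
    intro W hW hW1
    have hsymm : ∀ i j, W i j = W j i := fun i j => by simpa using hW.1.apply j i
    have hterm : ∀ p : {p : Fin n × Fin n // p.1 < p.2}, 0 ≤ 2 - W p.1.1 p.1.2 - W p.1.2 p.1.1 := by
      intro p
      have h := hW.dotProduct_mulVec_nonneg (Pi.single p.1.1 1 - Pi.single p.1.2 1)
      simp [mulVec_sub, sub_dotProduct, dotProduct_sub, hW1] at h
      linarith
    have hsum := sum_sum_eq_two_mul_sum_lt (fun i j => 2 - W i j - W j i)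
      (fun i j => by ring) (fun i => by rw [hW1]; ring)
    have htotal : ∑ p : {p : Fin n × Fin n // p.1 < p.2}, (2 - W p.1.1 p.1.2 - W p.1.2 p.1.1)
        ≤ (n : ℝ) ^ 2 := by
      have hnonneg := hW.sum_sum_nonneg
      have hcomm : ∑ i, ∑ j, W j i = ∑ i, ∑ j, W i j := Finset.sum_comm
      simp only [Finset.sum_sub_distrib, hcomm, Finset.sum_const, Finset.card_univ,
        Fintype.card_fin, nsmul_eq_mul] at hsum ⊢
      nlinarith
    refine Real.le_sqrt_of_sq_le ?_
    have hcs := sq_sum_le_card_mul_sum_sq (s := Finset.univ)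
      (f := fun p => √(∑ j, ∑ k, G p j * G p k * W j k))
    refine hcs.trans ?_
    have hsq : ∀ p, √(∑ j, ∑ k, G p j * G p k * W j k) ^ 2
        = (1 / ((n : ℝ) * (n - 1))) ^ 2 * (2 - W p.1.1 p.1.2 - W p.1.2 p.1.1) := by
      intro p
      rw [hrow W p hW1, Real.sq_sqrt (mul_nonneg (sq_nonneg _) (hterm p))]
    simp only [hsq, ← Finset.mul_sum, Finset.card_univ]
    rw [show (Fintype.card {p : Fin n × Fin n // p.1 < p.2} : ℝ) = n * (n - 1) / 2 by linarith]
    calc _ ≤ (n : ℝ) * (n - 1) / 2 * ((1 / ((n : ℝ) * (n - 1))) ^ 2 * (n : ℝ) ^ 2) := by gcongr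
      _ = _ := by field_simp
  refine ⟨hPSD, ⟨hPSD, hdiag, fun W hW hW1 => hobj ▸ hle W hW hW1⟩, ?_⟩
  refine IsGreatest.csSup_eq ⟨?_, ?_⟩
  · obtain ⟨v, rfl⟩ := hPSD.exists_gram
    have hv : ∀ j, ‖v j‖ = 1 := by
      intro j
      have h := hdiag j
      rw [Matrix.of_apply, real_inner_self_eq_norm_sq] at h
      exact (pow_eq_one_iff_of_nonneg (norm_nonneg _) two_ne_zero).mp h
    have hne : ∀ p, ∑ j, G p j • v j ≠ 0 := by
      intro p hp
      have h := norm_sum_smul_sq (G p) v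
      have h' := hrow _ p hdiag
      rw [hVdef, hVdef, if_neg p.2.ne, if_neg p.2.ne'] at h'
      simp only [Matrix.of_apply] at h'
      rw [hp, h', norm_zero] at h
      have : 0 < (1 / ((n : ℝ) * (n - 1))) ^ 2 * (2 - -(1 / ((n : ℝ) - 1)) - -(1 / (n - 1))) := by
        simp only [sub_neg_eq_add]
        positivity
      linarith
    obtain ⟨u, hu, huv⟩ := exists_stratBias_eq_gammaObj G v hne
    exact ⟨n, u, v, hu, hv, huv.trans hobj⟩
  · rintro b ⟨N, u, v, hu, hv, rfl⟩
    refine (stratBias_le_gammaObj G u v hu).trans (hle _ (Matrix.posSemidef_gram ℝ v) fun j => ?_)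
    rw [Matrix.of_apply, real_inner_self_eq_norm_sq, hv j, one_pow]
end
end

section
/- Let n ≥ 2. There exist constants C > 0 and C'' > 0 (depending only on n) such that for every ε with 0 < ε ≤ C, every ε-optimal finite-dimensional quantum strategy for CHSH(n) has d₂ ≥ min(C'' · ε^{−1/12}, 2^{⌊n/2⌋}), where d₂ is the dimension of the second tensor factor supporting the strategy. -/
open scoped BigOperators RealInnerProductSpace
open Matrix Kronecker

noncomputable section

/-- The game `CHSH(n)`: the graph game of the complete graph `K_n`
(which has `n(n−1)/2` edges). -/
def CHSHgame (n : ℕ) :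
    Matrix (GraphRow (⊤ : SimpleGraph (Fin n))) (Fin n) ℝ :=
  graphGame (⊤ : SimpleGraph (Fin n)) (n * (n - 1) / 2)

/-- A nonzero space carrying `2m` pairwise anticommuting involutions has dimension at least `2^m`. -/
theorem two_pow_le_finrank_of_anticommuting {E : Type*} [AddCommGroup E] [Module ℂ E]
    [FiniteDimensional ℂ E] (m : ℕ) (T : ℕ → Module.End ℂ E) (V : Submodule ℂ E) (hV : V ≠ ⊥)
    (hmap : ∀ i < 2 * m, ∀ x ∈ V, T i x ∈ V)
    (hsq : ∀ i < 2 * m, ∀ x ∈ V, T i (T i x) = x)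
    (hanti : ∀ i < 2 * m, ∀ j < 2 * m, i ≠ j → ∀ x ∈ V, T i (T j x) = -T j (T i x)) :
    2 ^ m ≤ Module.finrank ℂ V := by
  have : IsAddTorsionFree E := .of_isTorsionFree ℂ E
  induction m generalizing T V with
  | zero => simpa using Submodule.one_le_finrank_iff.mpr hV
  | succ m ih =>
    have hanti₀₁ := hanti 0 (by omega) 1 (by omega) (by omega)
    have hmap₁ := hmap 1 (by omega)
    have hsq₀ := hsq 0 (by omega)
    have hsq₁ := hsq 1 (by omega)
    have hmem : ∀ k, k < 2 * m → k + 2 < 2 * (m + 1) := fun k hk => by omega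
    have hanti₁ : ∀ k < 2 * m, ∀ x ∈ V, T (k + 2) (T 1 x) = -T 1 (T (k + 2) x) := fun k hk =>
      hanti (k + 2) (hmem k hk) 1 (by omega) (by omega)
    have hanti₀ : ∀ k < 2 * m, ∀ x ∈ V, T 0 (T (k + 2) x) = -T (k + 2) (T 0 x) := fun k hk =>
      hanti 0 (by omega) (k + 2) (hmem k hk) (by omega)
    set W : Submodule ℂ E := V ⊓ LinearMap.eqLocus (T 0) LinearMap.id with hW
    have memW : ∀ x, x ∈ W ↔ x ∈ V ∧ T 0 x = x := fun x => by
      simp [hW, LinearMap.mem_eqLocus]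
    have hWne : W ≠ ⊥ := by
      intro h
      obtain ⟨x, hx, hx0⟩ := Submodule.exists_mem_ne_zero_of_ne_bot hV
      have hneg : ∀ y ∈ V, T 0 y = -y := fun y hy => by
        have : y + T 0 y ∈ W := (memW _).2
          ⟨V.add_mem hy (hmap 0 (by omega) y hy), by rw [map_add, hsq₀ y hy, add_comm]⟩
        rw [h, Submodule.mem_bot] at this
        exact eq_neg_of_add_eq_zero_right this
      have h1 := hanti₀₁ x hx
      rw [hneg x hx, hneg _ (hmap₁ x hx), map_neg, neg_neg] at h1
      have h2 : T 1 x = 0 := self_eq_neg.mp h1.symm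
      exact hx0 (by rw [← hsq₁ x hx, h2, map_zero])
    have hWle := ih (fun k => Complex.I • (T 1 * T (k + 2))) W hWne
      (fun k hk x hx => by
        obtain ⟨hxV, hx0⟩ := (memW x).1 hx
        have hk' := hmap (k + 2) (hmem k hk) x hxV
        refine W.smul_mem _ ((memW _).2 ⟨hmap₁ _ hk', ?_⟩)
        rw [Module.End.mul_apply, hanti₀₁ _ hk', hanti₀ k hk x hxV, hx0, map_neg, neg_neg])
      (fun k hk x hx => by
        have hxV := ((memW x).1 hx).1
        have hk' := hmap (k + 2) (hmem k hk) x hxV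
        simp only [LinearMap.smul_apply, Module.End.mul_apply, map_smul, smul_smul,
          Complex.I_mul_I]
        rw [hanti₁ k hk _ hk', hsq _ (hmem k hk) x hxV, map_neg, hsq₁ x hxV]
        simp)
      (fun k hk l hl hkl x hx => by
        have hxV := ((memW x).1 hx).1
        have hk' := hmap (k + 2) (hmem k hk) x hxV
        have hl' := hmap (l + 2) (hmem l hl) x hxV
        simp only [LinearMap.smul_apply, Module.End.mul_apply, map_smul, smul_smul,
          Complex.I_mul_I]
        rw [hanti₁ k hk _ hl', hanti₁ l hl _ hk', map_neg, map_neg,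
          hsq₁ _ (hmap _ (hmem k hk) _ hl'), hsq₁ _ (hmap _ (hmem l hl) _ hk'),
          hanti _ (hmem k hk) _ (hmem l hl) (by omega) x hxV]
        simp)
    have hmapW : Module.finrank ℂ (W.map (T 1)) = Module.finrank ℂ W := by
      have hinj : Function.Injective ((T 1).domRestrict W) := by
        intro x y hxy
        have h := congrArg (T 1) hxy
        simp only [LinearMap.domRestrict_apply] at h
        rw [hsq₁ x ((memW _).1 x.2).1, hsq₁ y ((memW _).1 y.2).1] at h
        exact Subtype.ext h
      rw [← LinearMap.range_domRestrict, LinearMap.finrank_range_of_inj hinj]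
    have hdisj : Disjoint W (W.map (T 1)) := by
      rw [Submodule.disjoint_def]
      rintro _ hx ⟨y, hy, rfl⟩
      obtain ⟨hyV, hy0⟩ := (memW y).1 hy
      have h := ((memW _).1 hx).2
      rw [hanti₀₁ y hyV, hy0] at h
      exact self_eq_neg.mp h.symm
    have hle : W ⊔ W.map (T 1) ≤ V := by
      refine sup_le inf_le_left ?_
      rintro _ ⟨y, hy, rfl⟩
      exact hmap₁ y ((memW y).1 hy).1
    have h1 := Submodule.finrank_sup_add_finrank_inf_eq W (W.map (T 1))
    rw [hdisj.eq_bot, finrank_bot, hmapW] at h1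
    have h2 := Submodule.finrank_mono hle
    rw [pow_succ]
    omega

open scoped Matrix.Norms.Frobenius
open Module Filter Topology

section Frobenius
variable {m n : Type*} [Fintype m] [Fintype n]

theorem frobenius_norm_sq (M : Matrix m n ℂ) : ‖M‖ ^ 2 = ∑ i, ∑ j, ‖M i j‖ ^ 2 := by
  rw [Matrix.frobenius_norm_def, ← Real.sqrt_eq_rpow, Real.sq_sqrt (by positivity)]
  norm_cast

theorem frobenius_norm_sq_eq_re_trace (M : Matrix m n ℂ) : ‖M‖ ^ 2 = (Mᴴ * M).trace.re := by
  rw [frobenius_norm_sq, Finset.sum_comm]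
  simp only [Matrix.trace, Matrix.diag, Matrix.mul_apply, Matrix.conjTranspose_apply,
    Complex.re_sum, Complex.star_def, ← Complex.normSq_eq_conj_mul_self, Complex.ofReal_re,
    Complex.normSq_eq_norm_sq]

variable {Φ : Matrix m n ℂ} {Y : Matrix n n ℂ} {S : Matrix m m ℂ}

/-- If `Y` is a unitary observable, the squared defect of `Φ Y = S Φ`. -/
theorem norm_sq_intertwining_defect [DecidableEq n] (hY : Y.IsHermitian) (hY1 : Y * Y = 1)
    (hS : S.IsHermitian) (hΦ : ‖Φ‖ = 1) :
    ‖Φ * Y - S * Φ‖ ^ 2 =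
      1 + (Φᴴ * (S * S) * Φ).trace.re - 2 * (Φᴴ * S * Φ * Y).trace.re := by
  have h1 : (Φᴴ * Φ).trace.re = 1 := by rw [← frobenius_norm_sq_eq_re_trace, hΦ, one_pow]
  have h2 : (Y * Φᴴ * S * Φ).trace = (Φᴴ * S * Φ * Y).trace := by
    rw [Matrix.mul_assoc, Matrix.mul_assoc, Matrix.trace_mul_comm]
    simp only [Matrix.mul_assoc]
  have h3 : (Y * Φᴴ * Φ * Y).trace = (Φᴴ * Φ).trace := by
    rw [Matrix.trace_mul_comm, Matrix.mul_assoc Y, ← Matrix.mul_assoc, hY1, Matrix.one_mul]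
  have h4 : (Φ * Y - S * Φ)ᴴ * (Φ * Y - S * Φ) =
      Y * Φᴴ * Φ * Y - Y * Φᴴ * S * Φ - Φᴴ * S * Φ * Y + Φᴴ * (S * S) * Φ := by
    rw [Matrix.conjTranspose_sub, Matrix.conjTranspose_mul, Matrix.conjTranspose_mul, hY.eq, hS.eq]
    simp only [Matrix.sub_mul, Matrix.mul_sub, Matrix.mul_assoc]
    abel
  rw [frobenius_norm_sq_eq_re_trace, h4]
  simp only [Matrix.trace_add, Matrix.trace_sub, Complex.add_re, Complex.sub_re, h2, h3, h1]
  ring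

theorem norm_commutator_le (hY : Y.IsHermitian) (hS : S.IsHermitian) (hΦ : ‖Φ‖ = 1) :
    ‖S * (Φ * Φᴴ) - Φ * Φᴴ * S‖ ≤ 2 * ‖Φ * Y - S * Φ‖ := by
  set D := Φ * Y - S * Φ with hD
  have h : S * (Φ * Φᴴ) - Φ * Φᴴ * S = Φ * Dᴴ - D * Φᴴ := by
    rw [hD, Matrix.conjTranspose_sub, Matrix.conjTranspose_mul, Matrix.conjTranspose_mul,
      hY.eq, hS.eq]
    simp only [Matrix.sub_mul, Matrix.mul_sub, Matrix.mul_assoc]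
    abel
  have h1 := Matrix.frobenius_norm_mul Φ Dᴴ
  have h2 := Matrix.frobenius_norm_mul D Φᴴ
  rw [Matrix.frobenius_norm_conjTranspose, hΦ] at h1 h2
  rw [h]
  linarith [norm_sub_le (Φ * Dᴴ) (D * Φᴴ)]

theorem norm_involution_defect_le [DecidableEq n] (hY : Y.IsHermitian) (hY1 : Y * Y = 1)
    (hS : S.IsHermitian) (hΦ : ‖Φ‖ = 1) :
    ‖Φ * Φᴴ - S * S * (Φ * Φᴴ)‖ ≤ ‖Φ * Y - S * Φ‖ ^ 2 + 2 * ‖S‖ * ‖Φ * Y - S * Φ‖ := by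
  set D := Φ * Y - S * Φ with hD
  have hΦY : Φ * Y = D + S * Φ := by rw [hD]; abel
  have hYΦ : Y * Φᴴ = Dᴴ + Φᴴ * S := by
    have h := congrArg Matrix.conjTranspose hΦY
    rwa [Matrix.conjTranspose_add, Matrix.conjTranspose_mul, Matrix.conjTranspose_mul,
      hY.eq, hS.eq] at h
  have h : Φ * Φᴴ - S * S * (Φ * Φᴴ) = D * Dᴴ + D * Φᴴ * S + S * (D * Φᴴ) := by
    have h1 : Φ * Φᴴ = (Φ * Y) * (Y * Φᴴ) := by
      rw [Matrix.mul_assoc, ← Matrix.mul_assoc Y, hY1, Matrix.one_mul]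
    have h2 : S * Φ * (Dᴴ + Φᴴ * S) = S * (D * Φᴴ) + S * S * (Φ * Φᴴ) := by
      rw [← hYΦ, Matrix.mul_assoc, ← Matrix.mul_assoc Φ, hΦY]
      simp only [Matrix.add_mul, Matrix.mul_add, Matrix.mul_assoc]
    rw [sub_eq_iff_eq_add]
    nth_rewrite 1 [h1]
    rw [hΦY, hYΦ, Matrix.add_mul, h2]
    simp only [Matrix.mul_add, Matrix.mul_assoc]
    abel
  have h1 := Matrix.frobenius_norm_mul D Dᴴ
  have h2 := Matrix.frobenius_norm_mul (D * Φᴴ) S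
  have h3 := Matrix.frobenius_norm_mul S (D * Φᴴ)
  have h4 := Matrix.frobenius_norm_mul D Φᴴ
  rw [Matrix.frobenius_norm_conjTranspose] at h1 h4
  rw [hΦ, mul_one] at h4
  rw [h]
  refine (norm_add₃_le).trans ?_
  nlinarith [norm_nonneg S, mul_le_mul_of_nonneg_left h4 (norm_nonneg S)]

end Frobenius

section CHSH
variable {n : ℕ}

/-- The two rows of `CHSH(n)` on the edge `{i, j}`. -/
def edgeRow {i j : Fin n} (hij : i < j) (b : Bool) : GraphRow (⊤ : SimpleGraph (Fin n)) :=
  (⟨(i, j), hij, hij.ne⟩, b)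

/-- The sign of the second nonzero entry in a row of `CHSH(n)`. -/
def rowSign (r : GraphRow (⊤ : SimpleGraph (Fin n))) : ℝ := if r.2 then 1 else -1

/-- The observable `(x_i ± x_j)/√2` attached to a row of `CHSH(n)`. -/
def rowCombination {M : Type*} [AddCommGroup M] [Module ℝ M]
    (r : GraphRow (⊤ : SimpleGraph (Fin n))) (x : Fin n → M) : M :=
  (√2)⁻¹ • (x r.1.1.1 + rowSign r • x r.1.1.2)

/-- The absolute value of the nonzero entries of `CHSH(n)`. -/
def entryWeight (n : ℕ) : ℝ := 1 / (4 * ((n * (n - 1) / 2 : ℕ) : ℝ))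

theorem entryWeight_pos (hn : 2 ≤ n) : 0 < entryWeight n := by
  have h : 0 < n * (n - 1) / 2 := by
    refine Nat.div_pos ?_ two_pos
    calc 2 = 2 * 1 := rfl
      _ ≤ n * (n - 1) := Nat.mul_le_mul hn (by omega)
  unfold entryWeight
  positivity

theorem inv_sqrt_two_mul_self : (√2)⁻¹ * (√2)⁻¹ = (1 / 2 : ℝ) := by
  rw [← mul_inv, Real.mul_self_sqrt (by norm_num)]; norm_num

theorem rowSign_mul_self (r : GraphRow (⊤ : SimpleGraph (Fin n))) :
    rowSign r * rowSign r = 1 := by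
  unfold rowSign; split <;> norm_num

theorem CHSHgame_apply (r : GraphRow (⊤ : SimpleGraph (Fin n))) (k : Fin n) :
    CHSHgame n r k = (if k = r.1.1.1 then entryWeight n else 0) +
      if k = r.1.1.2 then rowSign r * entryWeight n else 0 := by
  have hne : r.1.1.1 ≠ r.1.1.2 := r.1.2.1.ne
  unfold CHSHgame graphGame entryWeight rowSign
  by_cases h1 : k = r.1.1.1
  · simp [h1, hne]
  · by_cases h2 : k = r.1.1.2 <;> cases r.2 <;> simp [h2, hne.symm, h1]

theorem sum_CHSHgame_smul {M : Type*} [AddCommGroup M] [Module ℝ M]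
    (r : GraphRow (⊤ : SimpleGraph (Fin n))) (x : Fin n → M) :
    ∑ k, CHSHgame n r k • x k = (entryWeight n * √2) • rowCombination r x := by
  simp only [CHSHgame_apply, add_smul, ite_smul, zero_smul, Finset.sum_add_distrib,
    Finset.sum_ite_eq', Finset.mem_univ, if_true, rowCombination, smul_smul]
  rw [mul_assoc, mul_inv_cancel₀ (by positivity), mul_one, smul_add, smul_smul, mul_comm]

theorem bddAbove_stratBias {ι κ : Type*} [Fintype ι] [Fintype κ] (G : Matrix ι κ ℝ) :
    BddAbove {b : ℝ | ∃ (N : ℕ) (u : ι → EuclideanSpace ℝ (Fin N))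
      (v : κ → EuclideanSpace ℝ (Fin N)),
      (∀ i, ‖u i‖ = 1) ∧ (∀ j, ‖v j‖ = 1) ∧ stratBias G u v = b} := by
  refine ⟨∑ i, ∑ j, |G i j|, ?_⟩
  rintro _ ⟨N, u, v, hu, hv, rfl⟩
  refine Finset.sum_le_sum fun i _ => Finset.sum_le_sum fun j _ => ?_
  refine (le_abs_self _).trans ?_
  rw [abs_mul]
  refine mul_le_of_le_one_right (abs_nonneg _) ?_
  simpa [hu, hv] using abs_real_inner_le_norm (u i) (v j)

theorem le_quantumBias_CHSHgame (n : ℕ) :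
    entryWeight n * √2 * Fintype.card (GraphRow (⊤ : SimpleGraph (Fin n))) ≤
      quantumBias (CHSHgame n) := by
  let v : Fin n → EuclideanSpace ℝ (Fin n) := fun j => EuclideanSpace.single j 1
  have hv : ∀ j, ‖v j‖ = 1 := fun j => by simp [v]
  have hu : ∀ r : GraphRow (⊤ : SimpleGraph (Fin n)),
      ⟪rowCombination r v, rowCombination r v⟫ = 1 := by
    intro r
    have hne : r.1.1.1 ≠ r.1.1.2 := r.1.2.1.ne
    simp only [rowCombination, v, inner_smul_left, inner_smul_right, inner_add_left,
      inner_add_right, EuclideanSpace.inner_single_right]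
    simp [hne, hne.symm]
    linear_combination (1 + rowSign r * rowSign r) * inv_sqrt_two_mul_self +
      1 / 2 * rowSign_mul_self r
  refine le_csSup (bddAbove_stratBias _) ⟨n, fun r => rowCombination r v, v, fun r => ?_, hv, ?_⟩
  · rw [norm_eq_sqrt_real_inner, hu, Real.sqrt_one]
  · have : ∀ r, ∑ j, CHSHgame n r j * ⟪rowCombination r v, v j⟫ = entryWeight n * √2 := fun r => by
      simp only [← inner_smul_right, ← inner_sum]
      rw [sum_CHSHgame_smul, inner_smul_right, hu, mul_one]
    simp only [stratBias, this, Finset.sum_const, Finset.card_univ, nsmul_eq_mul]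
    ring

theorem re_qStratBias_CHSHgame {d₁ d₂ : ℕ}
    (A : GraphRow (⊤ : SimpleGraph (Fin n)) → Matrix (Fin d₁) (Fin d₁) ℂ)
    (B : Fin n → Matrix (Fin d₂) (Fin d₂) ℂ) (Φ : Matrix (Fin d₂) (Fin d₁) ℂ) :
    (qStratBias (CHSHgame n) A B Φ.vec).re =
      entryWeight n * √2 * ∑ r, (Φᴴ * rowCombination r B * Φ * (A r)ᵀ).trace.re := by
  have h : ∀ r j, cinner Φ.vec ((A r ⊗ₖ B j) *ᵥ Φ.vec) = (Φᴴ * B j * Φ * (A r)ᵀ).trace := by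
    intro r j
    rw [Matrix.kronecker_mulVec_vec]
    change star (Φ.vec) ⬝ᵥ _ = _
    rw [Matrix.star_vec_dotProduct_vec]
    simp only [Matrix.mul_assoc]
  rw [qStratBias, Complex.re_sum, Finset.mul_sum]
  refine Finset.sum_congr rfl fun r _ => ?_
  have h2 : ∑ j, (CHSHgame n r j : ℂ) * (Φᴴ * B j * Φ * (A r)ᵀ).trace =
      (Φᴴ * (∑ j, CHSHgame n r j • B j) * Φ * (A r)ᵀ).trace := by
    simp only [Matrix.mul_sum, Matrix.sum_mul, Matrix.trace_sum, Matrix.mul_smul, Matrix.smul_mul,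
      Matrix.trace_smul, Complex.real_smul]
  simp only [h]
  rw [h2, sum_CHSHgame_smul]
  simp only [Matrix.mul_smul, Matrix.smul_mul, Matrix.trace_smul, Complex.smul_re, smul_eq_mul]

theorem rowCombination_mul_self {d : ℕ} {B : Fin n → Matrix (Fin d) (Fin d) ℂ}
    (hB : ∀ j, B j * B j = 1) (r : GraphRow (⊤ : SimpleGraph (Fin n))) :
    rowCombination r B * rowCombination r B = 1 +
      (1 / 2 * rowSign r) • (B r.1.1.1 * B r.1.1.2 + B r.1.1.2 * B r.1.1.1) := by
  rw [rowCombination, smul_mul_smul_comm, inv_sqrt_two_mul_self, Matrix.add_mul, Matrix.mul_add,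
    Matrix.mul_add, smul_mul_smul_comm, hB, hB, rowSign_mul_self, mul_smul_comm, smul_mul_assoc]
  module

theorem sum_rowCombination_mul_self {d : ℕ} {B : Fin n → Matrix (Fin d) (Fin d) ℂ}
    (hB : ∀ j, B j * B j = 1) :
    ∑ r : GraphRow (⊤ : SimpleGraph (Fin n)), rowCombination r B * rowCombination r B =
      (Fintype.card (GraphRow (⊤ : SimpleGraph (Fin n))) : ℝ) • 1 := by
  have hz : ∑ r : GraphRow (⊤ : SimpleGraph (Fin n)),
      (1 / 2 * rowSign r) • (B r.1.1.1 * B r.1.1.2 + B r.1.1.2 * B r.1.1.1) = 0 := by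
    unfold GraphRow
    rw [Fintype.sum_prod_type]
    refine Finset.sum_eq_zero fun p _ => ?_
    rw [Fintype.sum_bool, ← add_smul]
    simp [rowSign]
  simp only [rowCombination_mul_self hB, Finset.sum_add_distrib, hz]
  simp [← Nat.cast_smul_eq_nsmul ℝ]

/-- The relations forced on the second party by an optimal strategy: every row observable commutes
with the reduced density `R` and squares to the identity on its range. -/
def rowDefect {d : ℕ} (B : Fin n → Matrix (Fin d) (Fin d) ℂ) (R : Matrix (Fin d) (Fin d) ℂ) : ℝ :=
  ∑ r : GraphRow (⊤ : SimpleGraph (Fin n)),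
    (‖rowCombination r B * R - R * rowCombination r B‖ +
      ‖R - rowCombination r B * rowCombination r B * R‖)

theorem two_pow_le_of_rowDefect_eq_zero (hn : 2 ≤ n) {d : ℕ}
    {B : Fin n → Matrix (Fin d) (Fin d) ℂ} {R : Matrix (Fin d) (Fin d) ℂ}
    (hB : ∀ j, B j * B j = 1) (hR : R ≠ 0) (h : rowDefect B R = 0) : 2 ^ (n / 2) ≤ d := by
  have hrow : ∀ r : GraphRow (⊤ : SimpleGraph (Fin n)),
      rowCombination r B * R = R * rowCombination r B ∧
        rowCombination r B * rowCombination r B * R = R := by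
    intro r
    have h0 := (Finset.sum_eq_zero_iff_of_nonneg fun _ _ => by positivity).1 h r (Finset.mem_univ r)
    rw [add_eq_zero_iff_of_nonneg (norm_nonneg _) (norm_nonneg _), norm_eq_zero, norm_eq_zero,
      sub_eq_zero, sub_eq_zero] at h0
    exact ⟨h0.1, h0.2.symm⟩
  have hpair : ∀ i j : Fin n, i < j → B i * R = R * B i ∧ B j * R = R * B j ∧
      (B i * B j + B j * B i) * R = 0 := by
    intro i j hij
    have hcomm : ∀ b : Bool, (B i + (if b then 1 else -1 : ℝ) • B j) * R =
        R * (B i + (if b then 1 else -1 : ℝ) • B j) := by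
      intro b
      have h1 := (hrow (edgeRow hij b)).1
      simp only [rowCombination, smul_mul_assoc, mul_smul_comm] at h1
      exact smul_right_injective _ (by positivity : (√2)⁻¹ ≠ 0) h1
    have hp := hcomm true
    have hm := hcomm false
    have hs : (1 + (1 / 2 * rowSign (edgeRow hij true)) • (B i * B j + B j * B i)) * R = R := by
      have h1 := (hrow (edgeRow hij true)).2
      rwa [rowCombination_mul_self hB] at h1
    rw [Matrix.add_mul, Matrix.one_mul, add_eq_left, smul_mul_assoc] at hs
    simp only [if_true, Bool.false_eq_true, if_false, one_smul, neg_smul, Matrix.add_mul,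
      Matrix.mul_add, Matrix.neg_mul, Matrix.mul_neg] at hp hm
    refine ⟨?_, ?_, ?_⟩
    · linear_combination (norm := module) (1 / 2 : ℂ) • hp + (1 / 2 : ℂ) • hm
    · linear_combination (norm := module) (1 / 2 : ℂ) • hp - (1 / 2 : ℂ) • hm
    · exact (smul_eq_zero.1 hs).resolve_left (by norm_num [rowSign, edgeRow])
  have hcomm : ∀ i, B i * R = R * B i := by
    intro i
    obtain ⟨j, hj⟩ : ∃ j, j ≠ i :=
      have : Nontrivial (Fin n) := Fin.nontrivial_iff_two_le.2 hn
      exists_ne i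
    rcases lt_or_gt_of_ne hj with hlt | hlt
    · exact (hpair j i hlt).2.1
    · exact (hpair i j hlt).1
  have hanti : ∀ i j, i ≠ j → B i * B j * R = -(B j * B i * R) := by
    intro i j hij
    rw [eq_neg_iff_add_eq_zero, ← Matrix.add_mul]
    rcases lt_or_gt_of_ne hij with hlt | hlt
    · exact (hpair i j hlt).2.2
    · rw [add_comm]; exact (hpair j i hlt).2.2
  let T : ℕ → Module.End ℂ (Fin d → ℂ) := fun k =>
    if hk : k < n then (B ⟨k, hk⟩).mulVecLin else 0
  have hT : ∀ k (hk : k < n) x, T k x = B ⟨k, hk⟩ *ᵥ x := fun k hk x => by simp [T, hk]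
  have hlt : ∀ k < 2 * (n / 2), k < n := fun k hk => by omega
  have key := two_pow_le_finrank_of_anticommuting (n / 2) T (LinearMap.range R.mulVecLin)
    (by
      rw [ne_eq, LinearMap.range_eq_bot]
      exact fun h0 => hR (Matrix.toLin'.map_eq_zero_iff.1 h0))
    (by
      rintro k hk _ ⟨x, rfl⟩
      refine ⟨B ⟨k, hlt k hk⟩ *ᵥ x, ?_⟩
      rw [hT k (hlt k hk), Matrix.mulVecLin_apply, Matrix.mulVecLin_apply, Matrix.mulVec_mulVec,
        Matrix.mulVec_mulVec, hcomm])
    (fun k hk x _ => by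
      rw [hT k (hlt k hk), hT k (hlt k hk), Matrix.mulVec_mulVec, hB, Matrix.one_mulVec])
    (by
      rintro k hk l hl hkl _ ⟨x, rfl⟩
      rw [hT l (hlt l hl), hT k (hlt k hk), hT k (hlt k hk), hT l (hlt l hl),
        Matrix.mulVecLin_apply]
      simp only [Matrix.mulVec_mulVec, ← Matrix.mul_assoc]
      rw [hanti _ _ (by simpa using hkl), Matrix.neg_mulVec])
  exact key.trans ((Submodule.finrank_le _).trans (by simp))

theorem frobenius_norm_of_involution {d : ℕ} {M : Matrix (Fin d) (Fin d) ℂ} (hM : M.IsHermitian)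
    (hM1 : M * M = 1) : ‖M‖ = √d := by
  rw [← Real.sqrt_sq (norm_nonneg M), frobenius_norm_sq_eq_re_trace, hM.eq, hM1]
  simp

/-- By compactness, the defect is bounded below in dimensions smaller than `2^⌊n/2⌋`. -/
theorem exists_pos_le_rowDefect (hn : 2 ≤ n) {d : ℕ} (hd : d < 2 ^ (n / 2)) :
    ∃ c > 0, ∀ (B : Fin n → Matrix (Fin d) (Fin d) ℂ) (R : Matrix (Fin d) (Fin d) ℂ),
      (∀ j, (B j).IsHermitian ∧ B j * B j = 1) → ‖R‖ ≤ 1 → R.trace = 1 → c ≤ rowDefect B R := by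
  let K : Set ((Fin n → Matrix (Fin d) (Fin d) ℂ) × Matrix (Fin d) (Fin d) ℂ) :=
    {p | (∀ j, (p.1 j).IsHermitian ∧ p.1 j * p.1 j = 1) ∧ ‖p.2‖ ≤ 1 ∧ p.2.trace = 1}
  have hK : IsCompact K := by
    have : ProperSpace (Matrix (Fin d) (Fin d) ℂ) := FiniteDimensional.proper ℂ _
    refine Metric.isCompact_of_isClosed_isBounded ?_ ?_
    · simp only [K, Set.ofPred_and, Set.ofPred_forall, Matrix.IsHermitian]
      refine (isClosed_iInter fun j => ?_).inter (IsClosed.inter ?_ ?_)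
      · exact (isClosed_eq (by fun_prop) (by fun_prop)).inter
          (isClosed_eq (by fun_prop) (by fun_prop))
      · exact isClosed_le (by fun_prop) (by fun_prop)
      · exact isClosed_eq (by fun_prop) (by fun_prop)
    · refine isBounded_iff_forall_norm_le.2 ⟨max √d 1, fun p hp => ?_⟩
      refine max_le_max ?_ hp.2.1
      refine (pi_norm_le_iff_of_nonneg (Real.sqrt_nonneg _)).2 fun j => ?_
      exact (frobenius_norm_of_involution (hp.1 j).1 (hp.1 j).2).le
  have hcont : Continuous fun p : (Fin n → Matrix (Fin d) (Fin d) ℂ) × Matrix (Fin d) (Fin d) ℂ =>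
      rowDefect p.1 p.2 := by
    unfold rowDefect rowCombination
    fun_prop
  rcases K.eq_empty_or_nonempty with hE | hne
  · exact ⟨1, one_pos, fun B R hB hR hR1 =>
      (Set.eq_empty_iff_forall_notMem.1 hE (B, R) ⟨hB, hR, hR1⟩).elim⟩
  · obtain ⟨p, hp, hmin⟩ := hK.exists_isMinOn hne hcont.continuousOn
    refine ⟨rowDefect p.1 p.2, lt_of_le_of_ne ?_ fun h0 => ?_, fun B R hB hR hR1 =>
      isMinOn_iff.1 hmin (B, R) ⟨hB, hR, hR1⟩⟩
    · unfold rowDefect; positivity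
    · refine hd.not_ge (two_pow_le_of_rowDefect_eq_zero hn (fun j => (hp.1 j).2) ?_ h0.symm)
      intro hR
      simpa [hR] using hp.2.2

theorem isHermitian_rowCombination {d : ℕ} {B : Fin n → Matrix (Fin d) (Fin d) ℂ}
    (hB : ∀ j, (B j).IsHermitian) (r : GraphRow (⊤ : SimpleGraph (Fin n))) :
    (rowCombination r B).IsHermitian := by
  unfold rowCombination Matrix.IsHermitian
  simp [Matrix.conjTranspose_smul, (hB _).eq]

theorem norm_rowCombination_le {d : ℕ} {B : Fin n → Matrix (Fin d) (Fin d) ℂ}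
    (hB : ∀ j, (B j).IsHermitian ∧ B j * B j = 1) (r : GraphRow (⊤ : SimpleGraph (Fin n))) :
    ‖rowCombination r B‖ ≤ 2 * √d := by
  have hs : ‖rowSign r‖ = 1 := by unfold rowSign; split <;> simp
  have h1 : ‖(√2)⁻¹‖ ≤ 1 := by
    rw [norm_inv, Real.norm_of_nonneg (Real.sqrt_nonneg _)]
    exact inv_le_one_of_one_le₀ (Real.one_le_sqrt.2 (by norm_num))
  have h2 := norm_add_le (B r.1.1.1) (rowSign r • B r.1.1.2)
  rw [norm_smul, hs, one_mul, frobenius_norm_of_involution (hB _).1 (hB _).2,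
    frobenius_norm_of_involution (hB _).1 (hB _).2] at h2
  rw [rowCombination, norm_smul]
  calc _ ≤ 1 * (√d + √d) := by gcongr
    _ = 2 * √d := by ring

/-- In a nearly optimal strategy the reduced density of the second party has small defect. -/
theorem rowDefect_le_of_nearly_optimal (hn : 2 ≤ n) {d₁ d₂ : ℕ}
    {A : GraphRow (⊤ : SimpleGraph (Fin n)) → Matrix (Fin d₁) (Fin d₁) ℂ}
    {B : Fin n → Matrix (Fin d₂) (Fin d₂) ℂ} {Φ : Matrix (Fin d₂) (Fin d₁) ℂ}
    (hA : ∀ r, (A r).IsHermitian ∧ A r * A r = 1) (hB : ∀ j, (B j).IsHermitian ∧ B j * B j = 1)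
    (hΦ : ‖Φ‖ = 1) {δ : ℝ}
    (h : quantumBias (CHSHgame n) - entryWeight n * √2 * (δ / 2) ≤
      (qStratBias (CHSHgame n) A B Φ.vec).re) :
    rowDefect B (Φ * Φᴴ) ≤ Fintype.card (GraphRow (⊤ : SimpleGraph (Fin n))) *
      (2 * √δ + (√δ ^ 2 + 2 * (2 * √d₂) * √δ)) := by
  set N : ℝ := ((Fintype.card (GraphRow (⊤ : SimpleGraph (Fin n))) : ℕ) : ℝ) with hN
  have hY : ∀ r, (A r)ᵀ.IsHermitian := fun r => (hA r).1.transpose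
  have hY1 : ∀ r, (A r)ᵀ * (A r)ᵀ = 1 := fun r => by
    rw [← Matrix.transpose_mul, (hA r).2, Matrix.transpose_one]
  have hS := isHermitian_rowCombination fun j => (hB j).1
  have hsum : N - δ / 2 ≤ ∑ r, (Φᴴ * rowCombination r B * Φ * (A r)ᵀ).trace.re := by
    have hw : 0 < entryWeight n * √2 := mul_pos (entryWeight_pos hn) (by positivity)
    have h1 := le_quantumBias_CHSHgame n
    rw [re_qStratBias_CHSHgame] at h
    refine le_of_mul_le_mul_left ?_ hw
    linarith
  have hsq : ∑ r, (Φᴴ * (rowCombination r B * rowCombination r B) * Φ).trace.re = N := by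
    rw [← Complex.re_sum, ← Matrix.trace_sum, ← Matrix.sum_mul, ← Matrix.mul_sum,
      sum_rowCombination_mul_self fun j => (hB j).2, Matrix.mul_smul, Matrix.mul_one,
      Matrix.smul_mul, Matrix.trace_smul, Complex.smul_re, ← frobenius_norm_sq_eq_re_trace, hΦ]
    simp [hN]
  have htotal : ∑ r, ‖Φ * (A r)ᵀ - rowCombination r B * Φ‖ ^ 2 ≤ δ := by
    simp only [norm_sq_intertwining_defect (hY _) (hY1 _) (hS _) hΦ, Finset.sum_sub_distrib,
      Finset.sum_add_distrib, hsq, ← Finset.mul_sum, Finset.sum_const, Finset.card_univ,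
      nsmul_eq_mul, mul_one]
    linarith
  have hD : ∀ r, ‖Φ * (A r)ᵀ - rowCombination r B * Φ‖ ≤ √δ := fun r =>
    Real.le_sqrt_of_sq_le ((Finset.single_le_sum
      (f := fun r => ‖Φ * (A r)ᵀ - rowCombination r B * Φ‖ ^ 2)
      (fun _ _ => by positivity) (Finset.mem_univ r)).trans htotal)
  rw [hN, ← nsmul_eq_mul, ← Finset.card_univ]
  refine Finset.sum_le_card_nsmul _ _ _ fun r _ => add_le_add ?_ ?_
  · exact (norm_commutator_le (hY r) (hS r) hΦ).trans (by gcongr; exact hD r)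
  · refine (norm_involution_defect_le (hY r) (hY1 r) (hS r) hΦ).trans ?_
    gcongr
    · exact hD r
    · exact norm_rowCombination_le hB r
    · exact hD r

end CHSH

/-- dimension lower bound for near-optimal strategies of
`CHSH(n)`: there are constants `C, C'' > 0` such that for `0 < ε ≤ C`, every
`ε`-optimal quantum strategy for `CHSH(n)` has second-factor dimension at least
`min (C'' ε^{−1/12}) 2^{⌊n/2⌋}`. -/
theorem CHSH_dimension_lower_bound (n : ℕ) (hn : 2 ≤ n) :
    ∃ C C'' : ℝ, 0 < C ∧ 0 < C'' ∧
      ∀ ε : ℝ, 0 < ε → ε ≤ C →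
      ∀ (d₁ d₂ : ℕ)
        (A : GraphRow (⊤ : SimpleGraph (Fin n)) → Matrix (Fin d₁) (Fin d₁) ℂ)
        (B : Fin n → Matrix (Fin d₂) (Fin d₂) ℂ)
        (ψ : Fin d₁ × Fin d₂ → ℂ),
        (∀ i, (A i).IsHermitian ∧ (A i) ^ 2 = 1) →
        (∀ j, (B j).IsHermitian ∧ (B j) ^ 2 = 1) →
        cnorm ψ = 1 →
        quantumBias (CHSHgame n) - ε ≤ (qStratBias (CHSHgame n) A B ψ).re →
        min (C'' * ε ^ (-(1 : ℝ)/12)) ((2 : ℝ) ^ (n / 2)) ≤ (d₂ : ℝ) := by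
  have hw := entryWeight_pos hn
  let N : ℝ := ((Fintype.card (GraphRow (⊤ : SimpleGraph (Fin n))) : ℕ) : ℝ)
  have hev : ∀ᶠ ε : ℝ in 𝓝[>] 0, ∀ d ∈ Finset.range (2 ^ (n / 2)),
      ∀ (B : Fin n → Matrix (Fin d) (Fin d) ℂ) (R : Matrix (Fin d) (Fin d) ℂ),
      (∀ j, (B j).IsHermitian ∧ B j * B j = 1) → ‖R‖ ≤ 1 → R.trace = 1 →
      N * (2 * √(2 * ε / (entryWeight n * √2)) + (√(2 * ε / (entryWeight n * √2)) ^ 2 +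
        2 * (2 * √d) * √(2 * ε / (entryWeight n * √2)))) < rowDefect B R := by
    rw [Filter.eventually_all_finset]
    intro d hd
    obtain ⟨c, hc, hle⟩ := exists_pos_le_rowDefect hn (Finset.mem_range.1 hd)
    have hcont : Continuous fun ε : ℝ => N * (2 * √(2 * ε / (entryWeight n * √2)) +
        (√(2 * ε / (entryWeight n * √2)) ^ 2 +
          2 * (2 * √d) * √(2 * ε / (entryWeight n * √2)))) := by
      fun_prop
    have hlt := (hcont.tendsto 0).eventually_lt_const (u := c) (by simpa using hc)
    filter_upwards [hlt.filter_mono nhdsWithin_le_nhds] with ε hε B R hB hR hR1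
    exact hε.trans_le (hle B R hB hR hR1)
  obtain ⟨C, hC, hsub⟩ := mem_nhdsGT_iff_exists_Ioc_subset.1 hev
  refine ⟨C, 1, hC, one_pos, fun ε hε hεC d₁ d₂ A B ψ hA hB hψ hbias => ?_⟩
  refine (min_le_right _ _).trans ?_
  by_contra! hd
  have hA' : ∀ r, (A r).IsHermitian ∧ A r * A r = 1 := fun r => by simpa [sq] using hA r
  have hB' : ∀ j, (B j).IsHermitian ∧ B j * B j = 1 := fun j => by simpa [sq] using hB j
  let Φ : Matrix (Fin d₂) (Fin d₁) ℂ := Matrix.of fun b a => ψ (a, b)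
  have hψΦ : Φ.vec = ψ := rfl
  have hsq : ‖Φ‖ ^ 2 = 1 := by
    rw [cnorm, Real.sqrt_eq_one, Fintype.sum_prod_type, Finset.sum_comm] at hψ
    rw [frobenius_norm_sq]
    exact hψ
  have hΦ : ‖Φ‖ = 1 := (pow_eq_one_iff_of_nonneg (norm_nonneg Φ) two_ne_zero).1 hsq
  have hR : ‖Φ * Φᴴ‖ ≤ 1 := by
    simpa [Matrix.frobenius_norm_conjTranspose, hΦ] using Matrix.frobenius_norm_mul Φ Φᴴ
  have hR1 : (Φ * Φᴴ).trace = 1 := by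
    rw [Matrix.trace_mul_comm]
    refine Complex.ext ?_ ?_
    · rw [← frobenius_norm_sq_eq_re_trace, hsq, Complex.one_re]
    · exact Complex.conj_eq_iff_im.1 (by
        rw [← Complex.star_def, ← Matrix.trace_conjTranspose, Matrix.conjTranspose_mul,
          Matrix.conjTranspose_conjTranspose])
  refine absurd (rowDefect_le_of_nearly_optimal hn hA' hB' hΦ ?_) (not_le.2 (hsub ⟨hε, hεC⟩ d₂
    (Finset.mem_range.2 (by exact_mod_cast hd)) B (Φ * Φᴴ) hB' hR hR1))
  rw [hψΦ]
  have hcancel : entryWeight n * √2 * (2 * ε / (entryWeight n * √2) / 2) = ε := by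
    field_simp
  rwa [hcancel]
end
end

section
/- An m×n real matrix (c_{ij}) arises from a finite-dimensional quantum strategy — i.e., there exist d₁, d₂, self-adjoint complex matrices A_1,…,A_m of size d₁×d₁ and B_1,…,B_n of size d₂×d₂ with A_i² = I and B_j² = I, and a unit vector ψ ∈ ℂ^{d₁} ⊗ ℂ^{d₂} with c_{ij} = ⟨ψ, (A_i ⊗ B_j) ψ⟩ for all i, j — if and only if there exist N and vectors u_1,…,u_m, v_1,…,v_n ∈ ℝ^N with ‖u_i‖ ≤ 1 and ‖v_j‖ ≤ 1 for all i, j, such that c_{ij} = ⟨u_i, v_j⟩ for all i, j. -/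
open scoped BigOperators RealInnerProductSpace
open Matrix Kronecker

noncomputable section

/-- Real vectors are represented by Hermitian matrices which square to the squared length and
whose normalized trace form is the dot product. -/
theorem exists_clifford_matrices (N : ℕ) :
    ∃ (d : ℕ) (M : (Fin N → ℝ) → Matrix (Fin d) (Fin d) ℂ), 0 < d ∧
      (∀ x, (M x).IsHermitian) ∧
      (∀ x, M x * M x = ((∑ k, x k * x k : ℝ) : ℂ) • (1 : Matrix (Fin d) (Fin d) ℂ)) ∧
      ∀ x y, (M x * M y).trace = (d : ℂ) * ((∑ k, x k * y k : ℝ) : ℂ) := by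
  induction N with
  | zero => exact ⟨1, fun _ => 0, one_pos, fun _ => isHermitian_zero, by simp, by simp⟩
  | succ N ih =>
    obtain ⟨d, M, hd, hM, hsq, htr⟩ := ih
    let D : (Fin (N + 1) → ℝ) → Matrix (Fin d ⊕ Fin d) (Fin d ⊕ Fin d) ℂ := fun x =>
      fromBlocks (((x 0 : ℝ) : ℂ) • 1) (M (Fin.tail x)) (M (Fin.tail x)) (-((x 0 : ℝ) : ℂ) • 1)
    have hmul (x y : Fin (N + 1) → ℝ) :
        (D x).submatrix finSumFinEquiv.symm finSumFinEquiv.symm *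
          (D y).submatrix finSumFinEquiv.symm finSumFinEquiv.symm =
          (D x * D y).submatrix finSumFinEquiv.symm finSumFinEquiv.symm :=
      submatrix_mul_equiv _ _ _ _ _
    refine ⟨d + d, fun x => (D x).submatrix finSumFinEquiv.symm finSumFinEquiv.symm, by omega,
      fun x => ?_, fun x => ?_, fun x y => ?_⟩
    · refine IsHermitian.submatrix ?_ _
      refine IsHermitian.fromBlocks ?_ (hM _) ?_ <;> simp [IsHermitian, conjTranspose_smul]
    · have hD : D x * D x = ((∑ k, x k * x k : ℝ) : ℂ) • 1 := by
        simp only [D, fromBlocks_multiply, hsq]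
        rw [← fromBlocks_one, fromBlocks_smul, Fin.sum_univ_succ]
        congr 1 <;> simp [Fin.tail, add_smul, smul_smul, add_comm, -Complex.coe_smul]
      rw [hmul, hD, submatrix_smul]
      simp
    · have ht : (D x * D y).trace = (d + d : ℂ) * ((∑ k, x k * y k : ℝ) : ℂ) := by
        have htb (P Q R S : Matrix (Fin d) (Fin d) ℂ) :
            (fromBlocks P Q R S).trace = P.trace + S.trace := by simp [trace]
        simp only [D, fromBlocks_multiply, htb, trace_add, htr, Fin.sum_univ_succ, smul_mul_smul,
          mul_one, trace_smul, trace_one, Fintype.card_fin, smul_eq_mul, Complex.ofReal_add,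
          Complex.ofReal_mul, Fin.tail]
        ring
      rw [hmul, Nat.cast_add, ← ht]
      exact Equiv.sum_comp finSumFinEquiv.symm fun k => (D x * D y) k k

/-- The maximally entangled state on two copies of `Fin d → ℂ`. -/
def maxEntangled (d : ℕ) : Fin d × Fin d → ℂ :=
  fun p => if p.1 = p.2 then (((Real.sqrt d)⁻¹ : ℝ) : ℂ) else 0

theorem cnorm_maxEntangled {d : ℕ} (hd : 0 < d) : cnorm (maxEntangled d) = 1 := by
  have h : (d : ℝ) ≠ 0 := by positivity
  simp [cnorm, maxEntangled, Fintype.sum_prod_type, apply_ite, h]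

theorem cinner_maxEntangled {d : ℕ} (A B : Matrix (Fin d) (Fin d) ℂ) :
    cinner (maxEntangled d) ((A ⊗ₖ Bᵀ).mulVec (maxEntangled d)) = (d : ℂ)⁻¹ * (A * B).trace := by
  have h : ((((Real.sqrt d)⁻¹ : ℝ) : ℂ)) * (((Real.sqrt d)⁻¹ : ℝ) : ℂ) = (d : ℂ)⁻¹ := by
    rw [← Complex.ofReal_mul, ← mul_inv, Real.mul_self_sqrt d.cast_nonneg]
    simp
  simp only [cinner, maxEntangled, mulVec, dotProduct, Fintype.sum_prod_type, kroneckerMap_apply,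
    transpose_apply, apply_ite star, ite_mul, mul_ite, star_zero, zero_mul, mul_zero,
    Finset.sum_ite_eq, Finset.mem_univ, if_true, trace, diag_apply, mul_apply,
    Complex.star_def, Complex.conj_ofReal]
  simp only [← h, Finset.mul_sum]
  exact Finset.sum_congr rfl fun a _ => Finset.sum_congr rfl fun b _ => by ring

/-- A complex vector as a real Euclidean vector of real and imaginary parts. -/
def realification {ι : Type*} [Fintype ι] (x : ι → ℂ) : EuclideanSpace ℝ (ι ⊕ ι) :=
  WithLp.toLp 2 (Sum.elim (fun k => (x k).re) (fun k => (x k).im))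

theorem inner_realification {ι : Type*} [Fintype ι] (x y : ι → ℂ) :
    ⟪realification x, realification y⟫ = (cinner x y).re := by
  simp [realification, cinner, PiLp.inner_apply, Finset.sum_add_distrib, mul_comm]

theorem cinner_self {ι : Type*} [Fintype ι] (x : ι → ℂ) :
    cinner x x = ((cnorm x ^ 2 : ℝ) : ℂ) := by
  rw [cnorm, Real.sq_sqrt (by positivity)]
  simp [cinner, ← Complex.conj_mul']

theorem cinner_mulVec_mulVec {ι : Type*} [Fintype ι] {S : Matrix ι ι ℂ} (hS : S.IsHermitian)
    (T : Matrix ι ι ℂ) (x : ι → ℂ) :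
    cinner (S.mulVec x) (T.mulVec x) = cinner x ((S * T).mulVec x) := by
  change star (S.mulVec x) ⬝ᵥ T.mulVec x = star x ⬝ᵥ (S * T).mulVec x
  rw [star_mulVec, hS.eq, ← dotProduct_mulVec, mulVec_mulVec]

theorem norm_realification_mulVec {ι : Type*} [Fintype ι] [DecidableEq ι] {S : Matrix ι ι ℂ}
    (hS : S.IsHermitian) (hS2 : S * S = 1) {x : ι → ℂ} (hx : cnorm x = 1) :
    ‖realification (S.mulVec x)‖ = 1 := by
  rw [← sq_eq_sq₀ (norm_nonneg _) zero_le_one, ← real_inner_self_eq_norm_sq, inner_realification,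
    cinner_mulVec_mulVec hS, hS2, one_mulVec, cinner_self, hx]
  simp

/-- Tsirelson's characterization, finite-dimensional form: a
real `m × n` matrix is a quantum correlation matrix iff it is the matrix of
inner products of vectors of norm at most 1. -/
theorem quantum_correlation_iff_vectors {m n : ℕ} (c : Matrix (Fin m) (Fin n) ℝ) :
    (∃ (d₁ d₂ : ℕ) (A : Fin m → Matrix (Fin d₁) (Fin d₁) ℂ)
        (B : Fin n → Matrix (Fin d₂) (Fin d₂) ℂ) (ψ : Fin d₁ × Fin d₂ → ℂ),
      (∀ i, (A i).IsHermitian ∧ (A i) ^ 2 = 1) ∧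
      (∀ j, (B j).IsHermitian ∧ (B j) ^ 2 = 1) ∧
      cnorm ψ = 1 ∧
      ∀ i j, cinner ψ ((A i ⊗ₖ B j).mulVec ψ) = ((c i j : ℝ) : ℂ)) ↔
    (∃ (N : ℕ) (u : Fin m → EuclideanSpace ℝ (Fin N))
        (v : Fin n → EuclideanSpace ℝ (Fin N)),
      (∀ i, ‖u i‖ ≤ 1) ∧ (∀ j, ‖v j‖ ≤ 1) ∧
      ∀ i j, ⟪u i, v j⟫ = c i j) := by
  constructor
  · rintro ⟨d₁, d₂, A, B, ψ, hA, hB, hψ, hc⟩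
    let e := LinearIsometryEquiv.piLpCongrLeft 2 ℝ ℝ
      (Fintype.equivFin ((Fin d₁ × Fin d₂) ⊕ (Fin d₁ × Fin d₂)))
    refine ⟨_, fun i => e (realification ((A i ⊗ₖ 1).mulVec ψ)),
      fun j => e (realification ((1 ⊗ₖ B j).mulVec ψ)), fun i => ?_, fun j => ?_, fun i j => ?_⟩
    · rw [e.norm_map, norm_realification_mulVec _ _ hψ]
      · simp [IsHermitian, conjTranspose_kronecker, (hA i).1.eq]
      · rw [← mul_kronecker_mul, ← pow_two, (hA i).2, one_mul, one_kronecker_one]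
    · rw [e.norm_map, norm_realification_mulVec _ _ hψ]
      · simp [IsHermitian, conjTranspose_kronecker, (hB j).1.eq]
      · rw [← mul_kronecker_mul, one_mul, ← pow_two, (hB j).2, one_kronecker_one]
    · rw [e.inner_map_map, inner_realification, cinner_mulVec_mulVec, ← mul_kronecker_mul,
        mul_one, one_mul, hc, Complex.ofReal_re]
      simp [IsHermitian, conjTranspose_kronecker, (hA i).1.eq]
  · rintro ⟨N, u, v, hu, hv, hc⟩
    obtain ⟨d, M, hd, hM, hsq, htr⟩ := exists_clifford_matrices (N + 2)
    have hnorm (w : EuclideanSpace ℝ (Fin N)) (hw : ‖w‖ ≤ 1) :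
        √(1 - ‖w‖ ^ 2) * √(1 - ‖w‖ ^ 2) + ∑ k, w k * w k = 1 := by
      rw [Real.mul_self_sqrt (by nlinarith [norm_nonneg w]), EuclideanSpace.real_norm_sq_eq]
      simp [pow_two]
    let x i : Fin (N + 2) → ℝ := Fin.cons √(1 - ‖u i‖ ^ 2) (Fin.cons 0 (u i))
    let y j : Fin (N + 2) → ℝ := Fin.cons 0 (Fin.cons √(1 - ‖v j‖ ^ 2) (v j))
    have hx i : ∑ k, x i k * x i k = 1 := by
      simpa [x, Fin.sum_univ_succ] using hnorm (u i) (hu i)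
    have hy j : ∑ k, y j k * y j k = 1 := by
      simpa [y, Fin.sum_univ_succ] using hnorm (v j) (hv j)
    have hxy i j : ∑ k, x i k * y j k = c i j := by
      simp [x, y, Fin.sum_univ_succ, ← hc, PiLp.inner_apply, mul_comm]
    refine ⟨d, d, fun i => M (x i), fun j => (M (y j))ᵀ, maxEntangled d,
      fun i => ⟨hM _, ?_⟩, fun j => ⟨(hM _).transpose, ?_⟩, cnorm_maxEntangled hd,
      fun i j => ?_⟩
    · rw [pow_two, hsq, hx, Complex.ofReal_one, one_smul]
    · rw [pow_two, ← transpose_mul, hsq, hy, Complex.ofReal_one, one_smul, transpose_one]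
    · have h : (d : ℂ) ≠ 0 := by exact_mod_cast hd.ne'
      rw [cinner_maxEntangled, htr, hxy, inv_mul_cancel_left₀ h]
end
end
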